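/- arXiv:2409.08835 — 3 statements merged into one kernel-verified Lean document; each statement's English description precedes it below -/
import Mathlib

section
/- Let g : ℝ³ → [0,1] be a rotation-invariant mollifier, set χ := g*g, let h, ℓ > 0 be adapted to g, fix 0 < q < 1/2 and β, d, D, δ, R, R′ > 0 with 0 < δ < d²/2 and q ≤ 1/2 − δ/d², and let ρ₀ be a nonzero finite rotation-invariant Borel measure on ℝ³. For T > 0 let g_T(y) := T³g(Ty). Given f₀ ∈ C_b²(ℝ³, ℝ³), set f := g_T * f₀ (componentwise) and define for a nonzero finite Borel measure ρ: 𝓑(ρ) := m_q(χ*ρ) + ∫ f(y − m_q(χ*ρ)) dρ(y) ∈ ℝ³. Set H := H^χ_{q,ρ₀}. Then there exists a constant C > 0 such that for all T > 0, all p ∈ ℝ³, and all ρ, ρ′ such that (ρ₀, ρ, ρ′) is an admissible triple: | [p·𝓑(ρ′) − p·𝓑(ρ)]² − [ ∫ p·(H + f) d(ρ′ − ρ) − Σ_{j=1}^{3} (∫ ∂_{y_j}(p·f) dρ₀)·(∫ H_j d(ρ′ − ρ)) ]² | ≤ C·‖ρ′ − ρ‖²_TV·(‖ρ′ − ρ‖_TV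 + ‖g*(ρ − ρ₀)‖_TV + ‖g_T*(ρ − ρ₀)‖_TV)·|p|². -/
open MeasureTheory Measure Set Metric Filter
open scoped ENNReal NNReal RealInnerProductSpace BigOperators FourierTransform

noncomputable section

/-- Euclidean space `ℝ³`. -/
abbrev E3 := EuclideanSpace ℝ (Fin 3)

/-- A mollifier on `ℝ³`: a smooth, compactly supported, `[0,1]`-valued function with
integral one. -/
structure IsMollifier (χ : E3 → ℝ) : Prop where
  smooth : ContDiff ℝ (⊤ : ℕ∞) χ
  compactSupport : HasCompactSupport χ
  mem_Icc : ∀ y, χ y ∈ Set.Icc (0:ℝ) 1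
  integral_one : (∫ y, χ y) = 1

/-- Rotation invariance of a function on `ℝ³`. -/
def RotInv (g : E3 → ℝ) : Prop := ∀ x y : E3, ‖x‖ = ‖y‖ → g x = g y

/-- The `λ`-quantile `x^λ(ν) = sup {t : ν(-∞,t] ≤ λ·ν(ℝ)}` of a (finite Borel) measure on `ℝ`. -/
def quantile (ν : Measure ℝ) (lam : ℝ) : ℝ :=
  sSup {t : ℝ | (ν (Set.Iic t)).toReal ≤ lam * (ν Set.univ).toReal}

/-- The `j`-th marginal of a measure on `ℝ³`. -/
def marg (ρ : Measure E3) (j : Fin 3) : Measure ℝ := ρ.map (fun y => y j)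

/-- The mollification `χ*ρ` of a measure `ρ` on `ℝ³`: the measure with Lebesgue density
`x ↦ ∫ χ(x-y) dρ(y)`. -/
def mollify (χ : E3 → ℝ) (ρ : Measure E3) : Measure E3 :=
  volume.withDensity fun x => ENNReal.ofReal (∫ y, χ (x - y) ∂ρ)

/-- The `λ`-quantile `x^λ((χ*ρ)_j)` of the `j`-th marginal of the mollified measure. -/
def qtl (χ : E3 → ℝ) (ρ : Measure E3) (j : Fin 3) (lam : ℝ) : ℝ :=
  quantile (marg (mollify χ ρ) j) lam

/-- The function `f^χ_{j,t}(y) = ∫ χ(z)·1_{(-∞,t]}(y_j - z_j) dz`. -/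
def fchi (χ : E3 → ℝ) (j : Fin 3) (t : ℝ) (y : E3) : ℝ :=
  ∫ z, χ z * Set.indicator (Set.Iic t) (fun _ => (1:ℝ)) (y j - z j)

/-- The `j`-th standard basis vector of `ℝ³`. -/
def esingle (j : Fin 3) : E3 := EuclideanSpace.single j (1:ℝ)

/-- Constants `h, ℓ > 0` are adapted to `χ` if
`-∂_{y_j} f^χ_{j,t}(y) ≥ h·1_{(t-2ℓ,t+2ℓ)}(y_j)` for all `t, y, j`. -/
def Adapted (χ : E3 → ℝ) (h ℓ : ℝ) : Prop :=
  ∀ (j : Fin 3) (t : ℝ) (y : E3),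
    h * Set.indicator (Set.Ioo (t - 2*ℓ) (t + 2*ℓ)) (fun _ => (1:ℝ)) (y j)
      ≤ - fderiv ℝ (fchi χ j t) y (esingle j)

/-- Total variation distance `‖μ - ν‖_TV` of two finite measures. -/
def tv (μ ν : Measure E3) [IsFiniteMeasure μ] [IsFiniteMeasure ν] : ℝ :=
  ((μ.toSignedMeasure - ν.toSignedMeasure).totalVariation Set.univ).toReal

/-- Mollified total variation `‖g*(μ - ν)‖_TV`, i.e. the `L¹` norm of the difference of the
Lebesgue densities of `g*μ` and `g*ν`. -/
def tvMol (g : E3 → ℝ) (μ ν : Measure E3) : ℝ :=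
  ∫ x, |(∫ y, g (x - y) ∂μ) - (∫ y, g (x - y) ∂ν)|

/-- One component of the regularized median of a measure on `ℝ`:
the mean over the quantile window `[x^{1/2-q}, x^{1/2+q}]`. -/
def medComp (q : ℝ) (ν : Measure ℝ) : ℝ :=
  (∫ t in Set.Icc (quantile ν (1/2 - q)) (quantile ν (1/2 + q)), t ∂ν)
    / (ν (Set.Icc (quantile ν (1/2 - q)) (quantile ν (1/2 + q)))).toReal

/-- Assemble a vector of `ℝ³` from its coordinates. -/
def vec3 (f : Fin 3 → ℝ) : E3 := (EuclideanSpace.equiv (Fin 3) ℝ).symm f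

/-- The regularized median `m_q(ρ) ∈ ℝ³` (componentwise over the marginals;
by the junk-value conventions `m_q(0) = 0`). -/
def med (q : ℝ) (ρ : Measure E3) : E3 := vec3 fun j => medComp q (marg ρ j)

/-- The function `H^χ_{q,ρ₀} = (H₁,H₂,H₃) : ℝ³ → ℝ³` (componentwise). -/
def Hfun (χ : E3 → ℝ) (q : ℝ) (ρ₀ : Measure E3) (j : Fin 3) (y : E3) : ℝ :=
  (2 * q * (ρ₀ Set.univ).toReal)⁻¹ *
    ((∫ z, χ z *
        Set.indicator (Set.Icc (qtl χ ρ₀ j (1/2 - q)) (qtl χ ρ₀ j (1/2 + q)))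
          (fun _ => (1:ℝ)) (y j - z j) *
        (y j - z j - medComp q (marg (mollify χ ρ₀) j)))
      + (qtl χ ρ₀ j (1/2 + q) - medComp q (marg (mollify χ ρ₀) j))
          * (1/2 + q - fchi χ j (qtl χ ρ₀ j (1/2 + q)) y)
      + (medComp q (marg (mollify χ ρ₀) j) - qtl χ ρ₀ j (1/2 - q))
          * (1/2 - q - fchi χ j (qtl χ ρ₀ j (1/2 - q)) y))

/-- Mass and pair-correlation conditions `d ≤ ν(ℝ³) ≤ D`, `∬_{|x-y|>R} dν dν ≤ δ`. -/
def MassCond (d D δ R : ℝ) (ν : Measure E3) : Prop :=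
  d ≤ (ν Set.univ).toReal ∧ (ν Set.univ).toReal ≤ D ∧
    ((ν.prod ν) {p : E3 × E3 | R < dist p.1 p.2}).toReal ≤ δ

/-- Admissible triple `(ρ₀, ρ, ρ')` of measures on `ℝ³` (w.r.t. the mollifier `χ` and the
constants `q, ℓ, β, d, D, δ, R, R'`). -/
def Admissible (χ : E3 → ℝ) (q ℓ β d D δ R R' : ℝ) (ρ₀ ρ ρ' : Measure E3) : Prop :=
  (∃ qt : ℝ, 0 < qt ∧ qt ≤ q ∧
      ‖med qt ρ' - med qt ρ‖ + ‖med qt ρ - med qt ρ₀‖ ≤ R') ∧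
  MassCond d D δ R ρ₀ ∧ MassCond d D δ R ρ ∧ MassCond d D δ R ρ' ∧
  (∀ j : Fin 3,
    β ≤ (ρ₀ {y : E3 | |y j - qtl χ ρ₀ j (1/2 + q)| ≤ ℓ}).toReal ∧
    β ≤ (ρ₀ {y : E3 | |y j - qtl χ ρ₀ j (1/2 - q)| ≤ ℓ}).toReal)

/-- Convolution of two scalar functions on `ℝ³`. -/
def convFn (g₁ g₂ : E3 → ℝ) (x : E3) : ℝ := ∫ z, g₁ z * g₂ (x - z)

/-- Convolution of a scalar kernel with a vector-valued function on `ℝ³`. -/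
def convVec (k : E3 → ℝ) (F : E3 → E3) (y : E3) : E3 := ∫ z, k z • F (y - z)

/-- The boost function `𝓑(ρ) = m_q(χ*ρ) + ∫ f(y - m_q(χ*ρ)) dρ(y)`. -/
def Bfun (χ : E3 → ℝ) (q : ℝ) (f : E3 → E3) (ρ : Measure E3) : E3 :=
  med q (mollify χ ρ) + ∫ y, f (y - med q (mollify χ ρ)) ∂ρ

/-- `f ∈ C_b²(ℝ³,ℝ³)`: twice continuously differentiable with bounded derivatives
up to order two. -/
def CB2 (f : E3 → E3) : Prop :=
  ContDiff ℝ 2 f ∧ ∃ M : ℝ, ∀ y : E3,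
    ‖f y‖ ≤ M ∧ ‖fderiv ℝ f y‖ ≤ M ∧ ‖fderiv ℝ (fderiv ℝ f) y‖ ≤ M

/-- The polaron interaction `v(y) = π^{-3/2}|y|^{-2}`. -/
def vPol (y : E3) : ℝ := Real.pi ^ (-(3:ℝ)/2) * ‖y‖ ^ (-(2:ℝ))

/-- `h_ψ = |ψ|² * v`. -/
def hPek (ψ : E3 → ℂ) (x : E3) : ℝ := ∫ y, vPol (x - y) * ‖ψ y‖^2

/-- The Pekar energy
`𝓔(ψ,φ) = ‖φ‖² + ‖∇ψ‖² - 2∬ v(x-y)·Re φ(y)·|ψ(x)|² dx dy`. -/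
def PekarE (ψ φm : E3 → ℂ) : ℝ :=
  (∫ x, ‖φm x‖^2) + (∫ x, ‖fderiv ℝ ψ x‖^2)
    - 2 * ∫ pr : E3 × E3, vPol (pr.1 - pr.2) * (φm pr.2).re * ‖ψ pr.1‖^2
        ∂((volume : Measure E3).prod (volume : Measure E3))

/-- The Fourier transform of `v^Λ = χ(|∇| ≤ Λ)v`, namely
`k ↦ (2π)^{-1/2}|k|^{-1}·1_{|k| ≤ Λ}`. -/
def VLam (Λ : ℝ) (k : E3) : ℝ :=
  Set.indicator {k : E3 | ‖k‖ ≤ Λ} (fun k => (2 * Real.pi) ^ (-(1:ℝ)/2) * ‖k‖⁻¹) k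

/-- The Fourier transform of `w^Λ = (i∇/Δ)χ(|∇| > Λ)v`, namely
`k ↦ (2π)^{-1/2}|k|^{-3}·k·1_{|k| > Λ}`. -/
def WLam (Λ : ℝ) (k : E3) : E3 :=
  Set.indicator {k : E3 | Λ < ‖k‖} (fun k => ((2 * Real.pi) ^ (-(1:ℝ)/2) * (‖k‖^3)⁻¹) • k) k

/-- Pair correlation functional `∬_{|x-y| > R*} dρ(x) dρ(y)`. -/
def pairF (Rstar : ℝ) (ρ : Measure E3) : ℝ :=
  ((ρ.prod ρ) {p : E3 × E3 | Rstar < dist p.1 p.2}).toReal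

/-- The smooth cut-off functional
`F(ρ) = β₁(((ρ(ℝ³)-a)² + (∬_{|x-y|>R*}dρdρ - δ*)² - σ²)/κ²)`. -/
def Fcut (a Rstar δstar κ σ : ℝ) (β₁ : ℝ → ℝ) (ρ : Measure E3) : ℝ :=
  β₁ ((((ρ Set.univ).toReal - a)^2 + (pairF Rstar ρ - δstar)^2 - σ^2) / κ^2)


/-- Bracketing and defining inequalities of a quantile. -/
lemma quantile_spec (ν : Measure ℝ) [IsFiniteMeasure ν] {lam u v : ℝ}
    (hu : ν.real (Iic u) ≤ lam * ν.real univ) (hv : lam * ν.real univ < ν.real (Iic v)) :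
    u ≤ quantile ν lam ∧ quantile ν lam ≤ v ∧
      ν.real (Iio (quantile ν lam)) ≤ lam * ν.real univ ∧
      lam * ν.real univ ≤ ν.real (Iic (quantile ν lam)) := by
  set S : Set ℝ := {t : ℝ | ν.real (Iic t) ≤ lam * ν.real univ} with hS
  have hq : quantile ν lam = sSup S := rfl
  have hub : ∀ t ∈ S, t ≤ v := by
    intro t ht
    by_contra hc
    have : ν.real (Iic v) ≤ ν.real (Iic t) := measureReal_mono (Iic_subset_Iic.2 (not_le.1 hc).le)
    exact absurd (lt_of_lt_of_le hv (this.trans ht)) (lt_irrefl _)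
  have hbdd : BddAbove S := ⟨v, hub⟩
  have hne : S.Nonempty := ⟨u, hu⟩
  rw [hq]
  refine ⟨le_csSup hbdd hu, csSup_le hne hub, ?_, ?_⟩
  · obtain ⟨w, hw, hwlt, hwt⟩ := exists_seq_strictMono_tendsto (sSup S)
    have hU : Iio (sSup S) = ⋃ n, Iic (w n) := by
      ext t
      simp only [mem_Iio, mem_iUnion, mem_Iic]
      constructor
      · intro ht
        obtain ⟨n, hn⟩ := ((tendsto_order.1 hwt).1 t ht).exists
        exact ⟨n, hn.le⟩
      · rintro ⟨n, hn⟩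
        exact hn.trans_lt (hwlt n)
    have hlim : Tendsto (fun n => ν (Iic (w n))) atTop (nhds (ν (⋃ n, Iic (w n)))) :=
      tendsto_measure_iUnion_atTop (fun m n hmn => Iic_subset_Iic.2 (hw.monotone hmn))
    rw [← hU] at hlim
    have hlim' := (ENNReal.tendsto_toReal (measure_ne_top ν (Iio (sSup S)))).comp hlim
    refine le_of_tendsto' hlim' (fun n => ?_)
    obtain ⟨t, ht, hlt⟩ := exists_lt_of_lt_csSup hne (hwlt n)
    exact (measureReal_mono (Iic_subset_Iic.2 hlt.le) : ν.real (Iic (w n)) ≤ _).trans ht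
  · obtain ⟨w, hw, hwlt, hwt⟩ := exists_seq_strictAnti_tendsto (sSup S)
    have hU : Iic (sSup S) = ⋂ n, Iic (w n) := by
      ext t
      simp only [mem_iInter, mem_Iic]
      constructor
      · intro ht n
        exact ht.trans (hwlt n).le
      · intro ht
        exact ge_of_tendsto' hwt ht
    have hlim : Tendsto (fun n => ν (Iic (w n))) atTop (nhds (ν (⋂ n, Iic (w n)))) :=
      tendsto_measure_iInter_atTop (fun n => measurableSet_Iic.nullMeasurableSet)
        (fun m n hmn => Iic_subset_Iic.2 (hw.antitone hmn)) ⟨0, measure_ne_top _ _⟩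
    rw [← hU] at hlim
    have hlim' := (ENNReal.tendsto_toReal (measure_ne_top ν (Iic (sSup S)))).comp hlim
    refine ge_of_tendsto' hlim' (fun n => ?_)
    have : w n ∉ S := fun hc => absurd (le_csSup hbdd hc) (not_le.2 (hwlt n))
    exact (not_le.1 this).le

lemma monotone_measureReal_Iic (ν : Measure ℝ) [IsFiniteMeasure ν] :
    Monotone fun t => ν.real (Iic t) :=
  fun _ _ hst => measureReal_mono (Iic_subset_Iic.2 hst)

lemma measureReal_Icc_eq_sub (ν : Measure ℝ) [IsFiniteMeasure ν] [NullSingletonClass ν] {u v : ℝ}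
    (huv : u ≤ v) : ν.real (Icc u v) = ν.real (Iic v) - ν.real (Iic u) := by
  rw [measureReal_congr (Ioc_ae_eq_Icc (μ := ν)).symm,
    show Ioc u v = Iic v \ Iic u by ext; simp [and_comm],
    measureReal_sdiff (Iic_subset_Iic.2 huv) measurableSet_Iic]

/-- Integration by parts for the first moment of an atomless measure over an interval. -/
lemma setIntegral_Icc_id_eq (ν : Measure ℝ) [IsFiniteMeasure ν] [NullSingletonClass ν] {u v : ℝ}
    (huv : u ≤ v) :
    (∫ s in Icc u v, s ∂ν)
      = v * ν.real (Iic v) - u * ν.real (Iic u) - ∫ t in u..v, ν.real (Iic t) := by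
  have hswap : (∫ t in Ioc u v, ∫ s in Icc u v, (Iic t).indicator (fun _ => (1:ℝ)) s ∂ν)
      = ∫ s in Icc u v, (∫ t in Ioc u v, (Iic t).indicator (fun _ => (1:ℝ)) s) ∂ν := by
    apply integral_integral_swap
    refine Integrable.of_bound (C := 1) ?_ ?_
    · have : (Function.uncurry fun t s : ℝ => (Iic t).indicator (fun _ => (1:ℝ)) s)
          = {p : ℝ × ℝ | p.2 ≤ p.1}.indicator (fun _ => (1:ℝ)) := by
        ext ⟨t, s⟩; simp [indicator]
      rw [this]
      exact (measurable_const.indicator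
        (measurableSet_le measurable_snd measurable_fst)).aestronglyMeasurable
    · refine ae_of_all _ fun p => ?_
      simp only [Function.uncurry, indicator]
      split_ifs <;> simp
  have hleft : (∫ t in Ioc u v, ∫ s in Icc u v, (Iic t).indicator (fun _ => (1:ℝ)) s ∂ν)
      = (∫ t in u..v, ν.real (Iic t)) - (v - u) * ν.real (Iic u) := by
    rw [← intervalIntegral.integral_of_le huv]
    have h1 : ∀ t ∈ uIcc u v, (∫ s in Icc u v, (Iic t).indicator (fun _ => (1:ℝ)) s ∂ν)
        = ν.real (Iic t) - ν.real (Iic u) := by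
      intro t ht
      rw [uIcc_of_le huv] at ht
      rw [integral_indicator measurableSet_Iic, setIntegral_const, smul_eq_mul, mul_one,
        measureReal_restrict_apply measurableSet_Iic, ← measureReal_Icc_eq_sub ν ht.1]
      congr 1
      ext s
      simp only [mem_inter_iff, mem_Iic, mem_Icc]
      exact ⟨fun hs => ⟨hs.2.1, hs.1⟩, fun hs => ⟨hs.2, hs.1, hs.2.trans ht.2⟩⟩
    rw [intervalIntegral.integral_congr h1, intervalIntegral.integral_sub
      (monotone_measureReal_Iic ν).intervalIntegrable intervalIntegrable_const,
      intervalIntegral.integral_const, smul_eq_mul]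
  have hright : (∫ s in Icc u v, (∫ t in Ioc u v, (Iic t).indicator (fun _ => (1:ℝ)) s) ∂ν)
      = ∫ s in Icc u v, (v - s) ∂ν := by
    refine setIntegral_congr_fun measurableSet_Icc fun s hs => ?_
    have h2 : (fun t => (Iic t).indicator (fun _ => (1:ℝ)) s)
        = (Ici s).indicator (fun _ => (1:ℝ)) := by
      ext t; simp [indicator]
    simp only [h2]
    rw [integral_indicator measurableSet_Ici, setIntegral_const, smul_eq_mul, mul_one,
      measureReal_restrict_apply measurableSet_Ici,
      measureReal_congr (((Ioi_ae_eq_Ici (μ := (volume : Measure ℝ)) (a := s)).symm).inter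
        (Filter.EventuallyEq.refl _ (Ioc u v)))]
    have h3 : (Ioi s ∩ Ioc u v : Set ℝ) = Ioc s v := by
      ext t
      simp only [mem_inter_iff, mem_Ioi, mem_Ioc]
      exact ⟨fun ht => ⟨ht.1, ht.2.2⟩, fun ht => ⟨ht.1, hs.1.trans_lt ht.1, ht.2⟩⟩
    rw [h3, Real.volume_real_Ioc_of_le hs.2]
  rw [hswap, hright, integral_sub (integrable_const _), setIntegral_const, smul_eq_mul,
    measureReal_Icc_eq_sub ν huv] at hleft
  · linarith
  · exact (continuous_id.integrableOn_Icc)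

/-- Truncation of a real number to `[1/2 - q, 1/2 + q]`. -/
def clampHalf (q x : ℝ) : ℝ := max (1/2 - q) (min (1/2 + q) x)

lemma abs_clampHalf_sub_le (q x y : ℝ) : |clampHalf q x - clampHalf q y| ≤ |x - y| := by
  unfold clampHalf
  refine (abs_max_sub_max_le_max _ _ _ _).trans (max_le (by simp) ?_)
  exact (abs_min_sub_min_le_max _ _ _ _).trans (max_le (by simp) le_rfl)

lemma monotone_clampHalf (q : ℝ) : Monotone (clampHalf q) :=
  fun _ _ hxy => max_le_max le_rfl (min_le_min le_rfl hxy)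

/-- Data of the quantile window of an atomless measure whose window lies in `[-A, A]`. -/
lemma quantile_window (ν : Measure ℝ) [IsFiniteMeasure ν] [NullSingletonClass ν] {q A : ℝ}
    (hM : 0 < ν.real univ) (hq : 0 < q)
    (hlo : ν.real (Iic (-A)) ≤ (1/2 - q) * ν.real univ)
    (hhi : (1/2 + q) * ν.real univ < ν.real (Iic A)) :
    -A ≤ quantile ν (1/2 - q) ∧ quantile ν (1/2 - q) ≤ quantile ν (1/2 + q) ∧
      quantile ν (1/2 + q) ≤ A ∧
      ν.real (Iic (quantile ν (1/2 - q))) = (1/2 - q) * ν.real univ ∧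
      ν.real (Iic (quantile ν (1/2 + q))) = (1/2 + q) * ν.real univ := by
  have hab : (1/2 - q) * ν.real univ < (1/2 + q) * ν.real univ :=
    mul_lt_mul_of_pos_right (by linarith) hM
  obtain ⟨h1, -, h3, h4⟩ := quantile_spec ν hlo (hab.trans hhi)
  obtain ⟨-, k2, k3, k4⟩ := quantile_spec ν (hlo.trans hab.le) hhi
  rw [measureReal_congr (Iio_ae_eq_Iic (μ := ν))] at h3 k3
  refine ⟨h1, ?_, k2, le_antisymm h3 h4, le_antisymm k3 k4⟩
  by_contra hc
  have := monotone_measureReal_Iic ν (not_le.1 hc).le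
  simp only at this
  linarith

/-- Integral of the distribution function over the quantile window. -/
lemma integral_quantile_window (ν : Measure ℝ) [IsFiniteMeasure ν] [NullSingletonClass ν] {q A : ℝ}
    (hM : 0 < ν.real univ) (hq : 0 < q)
    (hlo : ν.real (Iic (-A)) ≤ (1/2 - q) * ν.real univ)
    (hhi : (1/2 + q) * ν.real univ < ν.real (Iic A)) :
    (∫ t in quantile ν (1/2 - q)..quantile ν (1/2 + q), ν.real (Iic t))
      = ν.real univ * (quantile ν (1/2 + q) * (1/2 + q) - quantile ν (1/2 - q) * (1/2 - q)
          - 2 * q * medComp q ν) := by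
  obtain ⟨-, h2, -, h4, h5⟩ := quantile_window ν hM hq hlo hhi
  have h6 := setIntegral_Icc_id_eq ν h2
  have h7 := measureReal_Icc_eq_sub ν h2
  unfold medComp
  rw [h6]
  change _ = ν.real univ * (_ - 2 * q * (_ / ν.real _))
  rw [h7, h4, h5]
  have : (1/2 + q) * ν.real univ - (1/2 - q) * ν.real univ = 2 * q * ν.real univ := by ring
  rw [this]
  field_simp
  ring

/-- The regularized median as an integral of the truncated distribution function. -/
lemma medComp_eq_integral (ν : Measure ℝ) [IsFiniteMeasure ν] [NullSingletonClass ν] {q A : ℝ}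
    (hM : 0 < ν.real univ) (hq : 0 < q)
    (hlo : ν.real (Iic (-A)) ≤ (1/2 - q) * ν.real univ)
    (hhi : (1/2 + q) * ν.real univ < ν.real (Iic A)) :
    2 * q * medComp q ν
      = ∫ t in (-A)..A, (1/2 - clampHalf q (ν.real (Iic t) / ν.real univ)) := by
  obtain ⟨h1, h2, h3, h4, h5⟩ := quantile_window ν hM hq hlo hhi
  have h6 := integral_quantile_window ν hM hq hlo hhi
  have hmono : Monotone fun t => clampHalf q (ν.real (Iic t) / ν.real univ) :=
    fun s t hst => monotone_clampHalf q
      (div_le_div_of_nonneg_right (monotone_measureReal_Iic ν hst) hM.le)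
  have hint : ∀ a b, IntervalIntegrable
      (fun t => clampHalf q (ν.real (Iic t) / ν.real univ)) volume a b :=
    fun a b => hmono.intervalIntegrable
  set x := quantile ν (1/2 - q)
  set y := quantile ν (1/2 + q)
  have hI1 : (∫ t in (-A)..x, clampHalf q (ν.real (Iic t) / ν.real univ))
      = (x + A) * (1/2 - q) := by
    rw [intervalIntegral.integral_congr (g := fun _ => 1/2 - q)]
    · rw [intervalIntegral.integral_const, smul_eq_mul]; ring
    · intro t ht
      rw [uIcc_of_le h1] at ht
      have : ν.real (Iic t) ≤ (1/2 - q) * ν.real univ := h4 ▸ monotone_measureReal_Iic ν ht.2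
      have : ν.real (Iic t) / ν.real univ ≤ 1/2 - q := by rwa [div_le_iff₀ hM]
      exact max_eq_left ((min_le_right _ _).trans this)
  have hI3 : (∫ t in y..A, clampHalf q (ν.real (Iic t) / ν.real univ))
      = (A - y) * (1/2 + q) := by
    rw [intervalIntegral.integral_congr (g := fun _ => 1/2 + q)]
    · rw [intervalIntegral.integral_const, smul_eq_mul]
    · intro t ht
      rw [uIcc_of_le h3] at ht
      have : (1/2 + q) * ν.real univ ≤ ν.real (Iic t) := h5 ▸ monotone_measureReal_Iic ν ht.1
      have : 1/2 + q ≤ ν.real (Iic t) / ν.real univ := by rwa [le_div_iff₀ hM]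
      simp only [clampHalf, min_eq_left this]
      exact max_eq_right (by linarith)
  have hI2 : (∫ t in x..y, clampHalf q (ν.real (Iic t) / ν.real univ))
      = (∫ t in x..y, ν.real (Iic t)) / ν.real univ := by
    rw [← intervalIntegral.integral_div]
    refine intervalIntegral.integral_congr fun t ht => ?_
    rw [uIcc_of_le h2] at ht
    have e1 : (1/2 - q) * ν.real univ ≤ ν.real (Iic t) := h4 ▸ monotone_measureReal_Iic ν ht.1
    have e2 : ν.real (Iic t) ≤ (1/2 + q) * ν.real univ := h5 ▸ monotone_measureReal_Iic ν ht.2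
    have e1 : 1/2 - q ≤ ν.real (Iic t) / ν.real univ := by rwa [le_div_iff₀ hM]
    have e2 : ν.real (Iic t) / ν.real univ ≤ 1/2 + q := by rwa [div_le_iff₀ hM]
    simp only [clampHalf, min_eq_right e2, max_eq_right e1]
  rw [intervalIntegral.integral_sub intervalIntegrable_const (hint _ _),
    ← intervalIntegral.integral_add_adjacent_intervals (hint (-A) x) (hint x A),
    ← intervalIntegral.integral_add_adjacent_intervals (hint x y) (hint y A), hI1, hI2, hI3, h6,
    intervalIntegral.integral_const, smul_eq_mul]
  field_simp
  ring

lemma abs_clampHalf_sub_sub_le (q u v : ℝ) :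
    |clampHalf q u - clampHalf q v - (u - v)| ≤ |u - v| := by
  have h := abs_clampHalf_sub_le q u v
  rcases le_total u v with huv | huv
  · have hm := monotone_clampHalf q huv
    rw [abs_of_nonpos (sub_nonpos.2 huv)] at h ⊢
    rw [abs_of_nonpos (sub_nonpos.2 hm)] at h
    rw [abs_le]; constructor <;> linarith
  · have hm := monotone_clampHalf q huv
    rw [abs_of_nonneg (sub_nonneg.2 huv)] at h ⊢
    rw [abs_of_nonneg (sub_nonneg.2 hm)] at h
    rw [abs_le]; constructor <;> linarith

/-- Linearization of the truncated integral around a profile `φ₀` crossing both truncation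
levels with a linear rate. -/
lemma abs_integral_clampHalf_sub_le {q A κ θ η x y : ℝ} {φ₀ φ φ' : ℝ → ℝ}
    (hφ₀ : Monotone φ₀) (hφ : Monotone φ) (hφ' : Monotone φ') (hκ : 0 < κ)
    (hAx : -A ≤ x) (hxy : x ≤ y) (hyA : y ≤ A)
    (hx : φ₀ x = 1/2 - q) (hy : φ₀ y = 1/2 + q)
    (hgx : ∀ t ∈ Icc (-A) A, κ * |t - x| ≤ |φ₀ t - (1/2 - q)|)
    (hgy : ∀ t ∈ Icc (-A) A, κ * |t - y| ≤ |φ₀ t - (1/2 + q)|)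
    (hη : ∀ t, |φ t - φ₀ t| ≤ η) (hη' : ∀ t, |φ' t - φ₀ t| ≤ η)
    (hθ : ∀ t, |φ t - φ' t| ≤ θ) :
    |(∫ t in (-A)..A, (clampHalf q (φ t) - clampHalf q (φ' t))) - ∫ t in x..y, (φ t - φ' t)|
      ≤ 4 * θ * η / κ := by
  have hη0 : 0 ≤ η := (abs_nonneg _).trans (hη 0)
  have hθ0 : 0 ≤ θ := (abs_nonneg _).trans (hθ 0)
  have hAA : -A ≤ A := hAx.trans (hxy.trans hyA)
  set r := η / κ with hr
  have hr0 : 0 ≤ r := by positivity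
  set I : ℝ → Set ℝ := fun c => Icc (c - r) (c + r)
  set D : ℝ → ℝ := fun t => clampHalf q (φ t) - clampHalf q (φ' t)
    - (Ioc x y).indicator (fun t => φ t - φ' t) t
  have hcint : ∀ ψ : ℝ → ℝ, Monotone ψ → IntegrableOn (fun t => clampHalf q (ψ t)) (Ioc (-A) A) :=
    fun ψ hψ => (((monotone_clampHalf q).comp hψ).intervalIntegrable (μ := volume)
      (a := -A) (b := A)).1
  have hint : ∀ ψ : ℝ → ℝ, Monotone ψ → IntegrableOn ψ (Ioc (-A) A) :=
    fun ψ hψ => (hψ.intervalIntegrable (μ := volume) (a := -A) (b := A)).1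
  have hsub : Ioc x y ⊆ Ioc (-A) A := Ioc_subset_Ioc hAx hyA
  have hkey : (∫ t in (-A)..A, (clampHalf q (φ t) - clampHalf q (φ' t)))
      - ∫ t in x..y, (φ t - φ' t) = ∫ t in Ioc (-A) A, D t := by
    rw [intervalIntegral.integral_of_le hAA, intervalIntegral.integral_of_le hxy,
      ← inter_eq_self_of_subset_right hsub, ← setIntegral_indicator measurableSet_Ioc]
    exact (integral_sub (f := fun t => clampHalf q (φ t) - clampHalf q (φ' t))
      ((hcint φ hφ).sub (hcint φ' hφ'))
      (((hint φ hφ).sub (hint φ' hφ')).indicator measurableSet_Ioc)).symm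
  have hDθ : ∀ t, |D t| ≤ θ := by
    intro t
    by_cases ht : t ∈ Ioc x y
    · simp only [D, indicator_of_mem ht]
      exact (abs_clampHalf_sub_sub_le q _ _).trans (hθ t)
    · simp only [D, indicator_of_notMem ht, sub_zero]
      exact (abs_clampHalf_sub_le q _ _).trans (hθ t)
  have hfar : ∀ c t l : ℝ, κ * |t - c| ≤ |φ₀ t - l| → t ∉ I c → η < |φ₀ t - l| := by
    intro c t l hg ht
    refine lt_of_lt_of_le ?_ hg
    have : r < |t - c| := by
      by_contra hc
      exact ht ⟨by linarith [(abs_le.1 (not_lt.1 hc)).1], by linarith [(abs_le.1 (not_lt.1 hc)).2]⟩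
    rw [hr, div_lt_iff₀ hκ] at this
    linarith
  have hD : ∀ t ∈ Ioc (-A) A,
      |D t| ≤ (I x).indicator (fun _ => θ) t + (I y).indicator (fun _ => θ) t := by
    intro t ht
    have ht' : t ∈ Icc (-A) A := ⟨ht.1.le, ht.2⟩
    by_cases hx' : t ∈ I x
    · rw [indicator_of_mem hx']
      exact (hDθ t).trans (le_add_of_nonneg_right (indicator_nonneg (fun _ _ => hθ0) t))
    by_cases hy' : t ∈ I y
    · rw [indicator_of_mem hy']
      exact (hDθ t).trans (le_add_of_nonneg_left (indicator_nonneg (fun _ _ => hθ0) t))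
    rw [indicator_of_notMem hx', indicator_of_notMem hy', add_zero]
    have fx := hfar x t _ (hgx t ht') hx'
    have fy := hfar y t _ (hgy t ht') hy'
    have e := abs_le.1 (hη t)
    have e' := abs_le.1 (hη' t)
    have hqq : 1/2 - q ≤ 1/2 + q := by rw [← hx, ← hy]; exact hφ₀ hxy
    have : D t = 0 := by
      rcases le_or_gt t x with htx | htx
      · have h0 : φ₀ t ≤ 1/2 - q := hx ▸ hφ₀ htx
        rw [abs_of_nonpos (by linarith)] at fx
        have n : t ∉ Ioc x y := fun hc => absurd hc.1 (not_lt.2 htx)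
        simp only [D, indicator_of_notMem n, clampHalf]
        rw [max_eq_left ((min_le_right _ _).trans (by linarith)),
          max_eq_left ((min_le_right _ _).trans (by linarith))]
        ring
      rcases le_or_gt t y with hty | hty
      · have h0 : 1/2 - q ≤ φ₀ t := hx ▸ hφ₀ htx.le
        have h1 : φ₀ t ≤ 1/2 + q := hy ▸ hφ₀ hty
        rw [abs_of_nonneg (by linarith)] at fx
        rw [abs_of_nonpos (by linarith)] at fy
        have n : t ∈ Ioc x y := ⟨htx, hty⟩
        simp only [D, indicator_of_mem n, clampHalf]
        rw [min_eq_right (by linarith), min_eq_right (by linarith), max_eq_right (by linarith),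
          max_eq_right (by linarith)]
        ring
      · have h1 : 1/2 + q ≤ φ₀ t := hy ▸ hφ₀ hty.le
        rw [abs_of_nonneg (by linarith)] at fy
        have n : t ∉ Ioc x y := fun hc => absurd hc.2 (not_le.2 hty)
        simp only [D, indicator_of_notMem n, clampHalf]
        rw [min_eq_left (by linarith), min_eq_left (by linarith)]
        ring
    simp [this]
  have hIint : ∀ c, Integrable ((I c).indicator fun _ => θ) volume := fun c =>
    (integrable_indicator_iff measurableSet_Icc).2 (integrableOn_const (by simp))
  have hIval : ∀ c, (∫ t in Ioc (-A) A, (I c).indicator (fun _ => θ) t) ≤ θ * (2 * r) := by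
    intro c
    refine (setIntegral_le_integral (hIint c)
      (ae_of_all _ fun t => indicator_nonneg (fun _ _ => hθ0) t)).trans ?_
    rw [integral_indicator measurableSet_Icc, setIntegral_const, smul_eq_mul,
      Real.volume_real_Icc_of_le (by linarith)]
    exact le_of_eq (by ring)
  rw [hkey]
  calc |∫ t in Ioc (-A) A, D t|
      ≤ ∫ t in Ioc (-A) A, ((I x).indicator (fun _ => θ) t + (I y).indicator (fun _ => θ) t) :=
        norm_integral_le_of_norm_le (f := D)
          (g := fun t => (I x).indicator (fun _ => θ) t + (I y).indicator (fun _ => θ) t)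
          ((hIint x).add (hIint y)).integrableOn
          ((ae_restrict_iff' measurableSet_Ioc).2 (ae_of_all _ fun t ht => hD t ht))
    _ = (∫ t in Ioc (-A) A, (I x).indicator (fun _ => θ) t)
          + ∫ t in Ioc (-A) A, (I y).indicator (fun _ => θ) t :=
        integral_add (hIint x).integrableOn (hIint y).integrableOn
    _ ≤ θ * (2 * r) + θ * (2 * r) := add_le_add (hIval x) (hIval y)
    _ = 4 * θ * η / κ := by rw [hr]; ring

/-- Total variation controls differences of integrals of bounded functions. -/
lemma abs_integral_sub_integral_le_tv (μ ν : Measure E3) [IsFiniteMeasure μ] [IsFiniteMeasure ν]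
    {u : E3 → ℝ} (hu : Measurable u) {B : ℝ} (hB : ∀ y, |u y| ≤ B) :
    |(∫ y, u y ∂μ) - ∫ y, u y ∂ν| ≤ B * tv μ ν := by
  set j := (μ.toSignedMeasure - ν.toSignedMeasure).toJordanDecomposition
  have hj : j.posPart.toSignedMeasure - j.negPart.toSignedMeasure
      = μ.toSignedMeasure - ν.toSignedMeasure :=
    SignedMeasure.toSignedMeasure_toJordanDecomposition _
  have hsum : μ + j.negPart = ν + j.posPart := by
    rw [← toSignedMeasure_eq_toSignedMeasure_iff, toSignedMeasure_add, toSignedMeasure_add]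
    rw [sub_eq_sub_iff_add_eq_add] at hj
    rw [← hj, add_comm]
  have hi : ∀ (m : Measure E3) [IsFiniteMeasure m], Integrable u m := fun m _ =>
    Integrable.of_bound hu.aestronglyMeasurable B (ae_of_all _ hB)
  have hbd : ∀ (m : Measure E3) [IsFiniteMeasure m], |∫ y, u y ∂m| ≤ B * m.real univ :=
    fun m _ => norm_integral_le_of_norm_le_const (f := u) (ae_of_all _ hB)
  have h1 : (∫ y, u y ∂μ) + ∫ y, u y ∂j.negPart = (∫ y, u y ∂ν) + ∫ y, u y ∂j.posPart := by
    rw [← integral_add_measure (hi _) (hi _), ← integral_add_measure (hi _) (hi _), hsum]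
  have htv : tv μ ν = j.posPart.real univ + j.negPart.real univ := by
    unfold tv SignedMeasure.totalVariation
    rw [Measure.add_apply, ENNReal.toReal_add (measure_ne_top _ _) (measure_ne_top _ _)]
    rfl
  rw [htv, show (∫ y, u y ∂μ) - ∫ y, u y ∂ν = (∫ y, u y ∂j.posPart) - ∫ y, u y ∂j.negPart by
    linarith]
  refine (abs_sub _ _).trans ?_
  linarith [hbd j.posPart, hbd j.negPart]

/-- A continuous, compactly supported, nonnegative, even kernel of unit mass. -/
structure IsEvenKernel (k : E3 → ℝ) : Prop where
  continuous : Continuous k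
  compactSupport : HasCompactSupport k
  nonneg : ∀ y, 0 ≤ k y
  even : ∀ y, k (-y) = k y
  integral_one : (∫ y, k y) = 1

lemma IsMollifier.isEvenKernel {g : E3 → ℝ} (hg : IsMollifier g) (hrot : RotInv g) :
    IsEvenKernel g :=
  ⟨hg.smooth.continuous, hg.compactSupport, fun y => (hg.mem_Icc y).1,
    fun y => hrot _ _ (norm_neg y), hg.integral_one⟩

namespace IsEvenKernel

variable {k : E3 → ℝ}

lemma scale (hk : IsEvenKernel k) {T : ℝ} (hT : 0 < T) :
    IsEvenKernel fun y => T^3 * k (T • y) where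
  continuous := continuous_const.mul (hk.continuous.comp (continuous_const_smul T))
  compactSupport := (hk.compactSupport.comp_smul hT.ne').mul_left
  nonneg y := mul_nonneg (by positivity) (hk.nonneg _)
  even y := by rw [smul_neg, hk.even]
  integral_one := by
    rw [integral_const_mul, Measure.integral_comp_smul, hk.integral_one, finrank_euclideanSpace,
      Fintype.card_fin, abs_of_pos (by positivity), smul_eq_mul, mul_one,
      mul_inv_cancel₀ (by positivity)]

lemma integrable (hk : IsEvenKernel k) : Integrable k :=
  hk.continuous.integrable_of_hasCompactSupport hk.compactSupport

lemma convFn_self (hk : IsEvenKernel k) : IsEvenKernel (convFn k k) := by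
  have he : convFn k k = convolution k k (ContinuousLinearMap.lsmul ℝ ℝ) volume := rfl
  refine ⟨?_, ?_, fun y => integral_nonneg fun z => mul_nonneg (hk.nonneg _) (hk.nonneg _), ?_, ?_⟩
  · rw [he]
    exact hk.compactSupport.continuous_convolution_left _ hk.continuous
      hk.integrable.locallyIntegrable
  · rw [he]
    exact hk.compactSupport.convolution _ hk.compactSupport
  · intro y
    unfold convFn
    rw [← integral_neg_eq_self]
    refine integral_congr_ae (ae_of_all _ fun z => ?_)
    simp only
    rw [hk.even, show -y - -z = -(y - z) by abel, hk.even]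
  · rw [he, integral_convolution _ hk.integrable hk.integrable, hk.integral_one]
    simp

section bounded

variable {w : E3 → ℝ} {B : ℝ}

lemma integrable_mul_comp_sub (hk : IsEvenKernel k) (hw : Measurable w) (hB : ∀ y, |w y| ≤ B)
    (y : E3) : Integrable fun z => k z * w (y - z) :=
  hk.integrable.mul_bdd (c := B)
    (hw.comp (measurable_const.sub measurable_id)).aestronglyMeasurable (ae_of_all _ fun _ => hB _)

lemma measurable_convFn (hk : IsEvenKernel k) (hw : Measurable w) : Measurable (convFn k w) := by
  have : StronglyMeasurable (Function.uncurry fun y z : E3 => k z * w (y - z)) :=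
    ((hk.continuous.measurable.comp measurable_snd).mul
      (hw.comp (measurable_fst.sub measurable_snd))).stronglyMeasurable
  exact this.integral_prod_right.measurable

lemma convFn_mono (hk : IsEvenKernel k) (hw : Measurable w) (hB : ∀ y, |w y| ≤ B)
    {w' : E3 → ℝ} (hw' : Measurable w') {B' : ℝ} (hB' : ∀ y, |w' y| ≤ B') {y : E3}
    (h : ∀ z, k z ≠ 0 → w (y - z) ≤ w' (y - z)) : convFn k w y ≤ convFn k w' y := by
  refine integral_mono (hk.integrable_mul_comp_sub hw hB y) (hk.integrable_mul_comp_sub hw' hB' y)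
    fun z => ?_
  by_cases hz : k z = 0
  · simp [hz]
  · exact mul_le_mul_of_nonneg_left (h z hz) (hk.nonneg z)

lemma convFn_const (hk : IsEvenKernel k) (c : ℝ) (y : E3) : convFn k (fun _ => c) y = c := by
  unfold convFn
  rw [integral_mul_const, hk.integral_one, one_mul]

lemma abs_convFn_le (hk : IsEvenKernel k) (hB : ∀ y, |w y| ≤ B) (y : E3) :
    |convFn k w y| ≤ B := by
  have : |convFn k w y| ≤ ∫ z, k z * B :=
    norm_integral_le_of_norm_le (f := fun z => k z * w (y - z)) (hk.integrable.mul_const B)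
      (ae_of_all _ fun z => by
        rw [norm_mul, Real.norm_of_nonneg (hk.nonneg z)]
        exact mul_le_mul_of_nonneg_left (hB _) (hk.nonneg z))
  rwa [integral_mul_const, hk.integral_one, one_mul] at this

lemma convFn_eq_integral_comp_sub (hk : IsEvenKernel k) (w : E3 → ℝ) (y : E3) :
    convFn k w y = ∫ x, k (x - y) * w x := by
  unfold convFn
  rw [← integral_sub_left_eq_self _ volume y]
  refine integral_congr_ae (ae_of_all _ fun x => ?_)
  simp only
  rw [sub_sub_cancel, ← hk.even, neg_sub]

lemma integrable_prod (hk : IsEvenKernel k) (ρ : Measure E3) [IsFiniteMeasure ρ]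
    (hw : Measurable w) (hB : ∀ y, |w y| ≤ B) :
    Integrable (Function.uncurry fun y x => k (x - y) * w x) (ρ.prod volume) := by
  have hm : Measurable (Function.uncurry fun y x : E3 => k (x - y) * w x) :=
    (hk.continuous.measurable.comp (measurable_snd.sub measurable_fst)).mul
      (hw.comp measurable_snd)
  have hi : ∀ y, Integrable fun x => k (x - y) * w x := fun y =>
    (hk.integrable.comp_sub_right y).mul_bdd (c := B) hw.aestronglyMeasurable (ae_of_all _ hB)
  refine (integrable_prod_iff hm.aestronglyMeasurable).2 ⟨ae_of_all _ hi, ?_⟩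
  refine Integrable.of_bound (C := B) hm.norm.stronglyMeasurable.integral_prod_right.aestronglyMeasurable
    (ae_of_all _ fun y => ?_)
  rw [Real.norm_of_nonneg (integral_nonneg fun _ => norm_nonneg _)]
  calc (∫ x, ‖k (x - y) * w x‖) ≤ ∫ x, k (x - y) * B :=
        integral_mono (hi y).norm ((hk.integrable.comp_sub_right y).mul_const B) fun x => by
          simp only [norm_mul, Real.norm_of_nonneg (hk.nonneg _)]
          exact mul_le_mul_of_nonneg_left (hB _) (hk.nonneg _)
    _ = B := by rw [integral_mul_const, integral_sub_right_eq_self k y, hk.integral_one, one_mul]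

lemma integral_convFn (hk : IsEvenKernel k) (ρ : Measure E3) [IsFiniteMeasure ρ]
    (hw : Measurable w) (hB : ∀ y, |w y| ≤ B) :
    (∫ y, convFn k w y ∂ρ) = ∫ x, (∫ y, k (x - y) ∂ρ) * w x := by
  simp_rw [hk.convFn_eq_integral_comp_sub w]
  rw [integral_integral_swap (hk.integrable_prod ρ hw hB)]
  simp_rw [integral_mul_const]

lemma integrable_convFn (hk : IsEvenKernel k) (ρ : Measure E3) [IsFiniteMeasure ρ]
    (hw : Measurable w) (hB : ∀ y, |w y| ≤ B) : Integrable (convFn k w) ρ :=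
  Integrable.of_bound (C := B) (hk.measurable_convFn hw).aestronglyMeasurable
    (ae_of_all _ fun y => hk.abs_convFn_le hB y)

lemma integrable_density (hk : IsEvenKernel k) (ρ : Measure E3) [IsFiniteMeasure ρ] :
    Integrable fun x => ∫ y, k (x - y) ∂ρ := by
  have := (hk.integrable_prod ρ (w := fun _ => 1) (B := 1) measurable_const
    (by simp)).integral_prod_right
  simpa [Function.uncurry] using this

lemma density_nonneg (hk : IsEvenKernel k) (ρ : Measure E3) (x : E3) : 0 ≤ ∫ y, k (x - y) ∂ρ :=
  integral_nonneg fun _ => hk.nonneg _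

lemma measurable_density (hk : IsEvenKernel k) (ρ : Measure E3) [IsFiniteMeasure ρ] :
    Measurable fun x => ∫ y, k (x - y) ∂ρ := by
  have : StronglyMeasurable (Function.uncurry fun x y : E3 => k (x - y)) :=
    (hk.continuous.measurable.comp (measurable_fst.sub measurable_snd)).stronglyMeasurable
  exact this.integral_prod_right.measurable

lemma tvMol_nonneg (k : E3 → ℝ) (μ ν : Measure E3) : 0 ≤ tvMol k μ ν :=
  integral_nonneg fun _ => abs_nonneg _

lemma abs_integral_convFn_sub_le (hk : IsEvenKernel k) (μ ν : Measure E3) [IsFiniteMeasure μ]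
    [IsFiniteMeasure ν] (hw : Measurable w) (hB : ∀ y, |w y| ≤ B) :
    |(∫ y, convFn k w y ∂μ) - ∫ y, convFn k w y ∂ν| ≤ B * tvMol k μ ν := by
  have hi : ∀ (ρ : Measure E3) [IsFiniteMeasure ρ],
      Integrable fun x => (∫ y, k (x - y) ∂ρ) * w x := fun ρ _ =>
    (hk.integrable_density ρ).mul_bdd (c := B) hw.aestronglyMeasurable (ae_of_all _ hB)
  rw [hk.integral_convFn μ hw hB, hk.integral_convFn ν hw hB, ← integral_sub (hi μ) (hi ν), tvMol,
    ← integral_const_mul]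
  refine norm_integral_le_of_norm_le
    (f := fun x => (∫ y, k (x - y) ∂μ) * w x - (∫ y, k (x - y) ∂ν) * w x)
    (((hk.integrable_density μ).sub (hk.integrable_density ν)).norm.const_mul B)
    (ae_of_all _ fun x => ?_)
  rw [← sub_mul, norm_mul, mul_comm B]
  exact mul_le_mul_of_nonneg_left (hB x) (norm_nonneg _)

lemma isFiniteMeasure_mollify (hk : IsEvenKernel k) (ρ : Measure E3) [IsFiniteMeasure ρ] :
    IsFiniteMeasure (mollify k ρ) :=
  isFiniteMeasure_withDensity_ofReal (hk.integrable_density ρ).2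

lemma integral_mollify (hk : IsEvenKernel k) (ρ : Measure E3) [IsFiniteMeasure ρ]
    (hw : Measurable w) (hB : ∀ y, |w y| ≤ B) :
    (∫ x, w x ∂(mollify k ρ)) = ∫ y, convFn k w y ∂ρ := by
  rw [hk.integral_convFn ρ hw hB, mollify, integral_withDensity_eq_integral_toReal_smul
    (hk.measurable_density ρ).ennreal_ofReal (by simp)]
  simp_rw [ENNReal.toReal_ofReal (hk.density_nonneg ρ _), smul_eq_mul]

lemma convFn_convFn_self (hk : IsEvenKernel k) (hw : Measurable w) (hB : ∀ y, |w y| ≤ B)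
    (y : E3) : convFn (convFn k k) w y = convFn k (convFn k w) y := by
  set ρ : Measure E3 := volume.withDensity fun x => ENNReal.ofReal (k x)
  have : IsFiniteMeasure ρ := isFiniteMeasure_withDensity_ofReal hk.integrable.2
  have hρ : ∀ F : E3 → ℝ, (∫ x, F x ∂ρ) = ∫ x, k x * F x := fun F => by
    rw [integral_withDensity_eq_integral_toReal_smul hk.continuous.measurable.ennreal_ofReal
      (by simp)]
    simp_rw [ENNReal.toReal_ofReal (hk.nonneg _), smul_eq_mul]
  have h := hk.integral_convFn ρ (w := fun x => w (y - x)) (B := B)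
    (hw.comp (measurable_const.sub measurable_id)) (fun x => hB _)
  simp_rw [hρ] at h
  refine h.symm.trans (integral_congr_ae (ae_of_all _ fun x => ?_))
  simp only
  congr 1
  unfold convFn
  rw [← integral_neg_eq_self]
  refine integral_congr_ae (ae_of_all _ fun z => ?_)
  simp only
  rw [hk.even, show y - (x - -z) = y - x - z by abel]

end bounded

end IsEvenKernel

lemma measurable_coord (j : Fin 3) : Measurable fun y : E3 => y j := by fun_prop

lemma volume_coord_eq (j : Fin 3) (c : ℝ) : (volume : Measure E3) {y | y j = c} = 0 := by
  have h := (EuclideanSpace.volume_preserving_symm_measurableEquiv_toLp (Fin 3)).symm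
  rw [← h.measure_preimage_equiv]
  exact Measure.pi_hyperplane (fun _ : Fin 3 => (volume : Measure ℝ)) j c

/-- Indicator of the half space `{y : y_j ≤ t}`. -/
def halfSpaceInd (j : Fin 3) (t : ℝ) (y : E3) : ℝ := (Iic t).indicator (fun _ => (1:ℝ)) (y j)

lemma fchi_eq_convFn (k : E3 → ℝ) (j : Fin 3) (t : ℝ) :
    fchi k j t = convFn k (halfSpaceInd j t) := rfl

lemma measurable_halfSpaceInd (j : Fin 3) (t : ℝ) : Measurable (halfSpaceInd j t) :=
  (measurable_const.indicator measurableSet_Iic).comp (measurable_coord j)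

lemma halfSpaceInd_nonneg (j : Fin 3) (t : ℝ) (y : E3) : 0 ≤ halfSpaceInd j t y :=
  indicator_nonneg (fun _ _ => zero_le_one) _

lemma halfSpaceInd_le_one (j : Fin 3) (t : ℝ) (y : E3) : halfSpaceInd j t y ≤ 1 :=
  indicator_le_self' (f := fun _ => (1:ℝ)) (fun _ _ => zero_le_one) _

lemma abs_halfSpaceInd_le (j : Fin 3) (t : ℝ) (y : E3) : |halfSpaceInd j t y| ≤ 1 := by
  rw [abs_of_nonneg (halfSpaceInd_nonneg j t y)]
  exact halfSpaceInd_le_one j t y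

namespace IsEvenKernel

variable {k : E3 → ℝ}

lemma measurable_fchi (hk : IsEvenKernel k) (j : Fin 3) (t : ℝ) : Measurable (fchi k j t) :=
  hk.measurable_convFn (measurable_halfSpaceInd j t)

lemma abs_fchi_le (hk : IsEvenKernel k) (j : Fin 3) (t : ℝ) (y : E3) : |fchi k j t y| ≤ 1 :=
  hk.abs_convFn_le (abs_halfSpaceInd_le j t) y

lemma isFiniteMeasure_marg (hk : IsEvenKernel k) (ρ : Measure E3) [IsFiniteMeasure ρ]
    (j : Fin 3) : IsFiniteMeasure (marg (mollify k ρ) j) := by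
  have := hk.isFiniteMeasure_mollify ρ
  unfold marg
  infer_instance

lemma integral_marg (hk : IsEvenKernel k) (ρ : Measure E3) [IsFiniteMeasure ρ] (j : Fin 3)
    {u : ℝ → ℝ} (hu : Measurable u) {B : ℝ} (hB : ∀ s, |u s| ≤ B) :
    (∫ s, u s ∂(marg (mollify k ρ) j)) = ∫ y, convFn k (fun x => u (x j)) y ∂ρ := by
  rw [← hk.integral_mollify ρ (w := fun x : E3 => u (x j)) (hu.comp (measurable_coord j))
    (fun y => hB _)]
  exact integral_map (measurable_coord j).aemeasurable hu.aestronglyMeasurable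

lemma marg_real_Iic (hk : IsEvenKernel k) (ρ : Measure E3) [IsFiniteMeasure ρ] (j : Fin 3)
    (t : ℝ) : (marg (mollify k ρ) j).real (Iic t) = ∫ y, fchi k j t y ∂ρ := by
  have := hk.integral_marg ρ j (u := (Iic t).indicator fun _ => (1:ℝ)) (B := 1)
    (measurable_const.indicator measurableSet_Iic) (fun s => by
      simp only [indicator]; split_ifs <;> simp)
  rw [integral_indicator measurableSet_Iic, setIntegral_const, smul_eq_mul, mul_one] at this
  exact this

lemma marg_real_univ (hk : IsEvenKernel k) (ρ : Measure E3) [IsFiniteMeasure ρ] (j : Fin 3) :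
    (marg (mollify k ρ) j).real univ = ρ.real univ := by
  have := hk.integral_marg ρ j (u := fun _ => (1:ℝ)) (B := 1) measurable_const (by simp)
  simp_rw [hk.convFn_const] at this
  simpa using this

lemma nullSingletonClass_marg (k : E3 → ℝ) (ρ : Measure E3) (j : Fin 3) :
    NullSingletonClass (marg (mollify k ρ) j) where
  measure_singleton c := by
    unfold marg
    rw [Measure.map_apply (measurable_coord j) (measurableSet_singleton c)]
    exact withDensity_absolutelyContinuous _ _ (volume_coord_eq j c)

section Hfun

lemma abs_Hfun_aux (a b m s : ℝ) :
    |(Icc a b).indicator (fun _ => (1:ℝ)) s * (s - m)| ≤ |a - m| + |b - m| := by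
  by_cases hs : s ∈ Icc a b
  · rw [indicator_of_mem hs, one_mul]
    have e1 := neg_abs_le (a - m)
    have e2 := le_abs_self (b - m)
    rw [abs_le]
    constructor <;> linarith [hs.1, hs.2, abs_nonneg (a - m), abs_nonneg (b - m)]
  · rw [indicator_of_notMem hs, zero_mul, abs_zero]
    positivity

lemma measurable_Hfun_aux (a b m : ℝ) :
    Measurable fun s => (Icc a b).indicator (fun _ => (1:ℝ)) s * (s - m) :=
  (measurable_const.indicator measurableSet_Icc).mul (measurable_id.sub_const m)

lemma Hfun_eq (k : E3 → ℝ) (q : ℝ) (ρ₀ : Measure E3) (j : Fin 3) (y : E3) :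
    Hfun k q ρ₀ j y = (2 * q * (ρ₀ Set.univ).toReal)⁻¹ *
    (convFn k (fun x => (Icc (qtl k ρ₀ j (1/2 - q)) (qtl k ρ₀ j (1/2 + q))).indicator
        (fun _ => (1:ℝ)) (x j) * (x j - medComp q (marg (mollify k ρ₀) j))) y
      + (qtl k ρ₀ j (1/2 + q) - medComp q (marg (mollify k ρ₀) j))
          * (1/2 + q - fchi k j (qtl k ρ₀ j (1/2 + q)) y)
      + (medComp q (marg (mollify k ρ₀) j) - qtl k ρ₀ j (1/2 - q))
          * (1/2 - q - fchi k j (qtl k ρ₀ j (1/2 - q)) y)) := by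
  unfold Hfun convFn
  simp only [mul_assoc, PiLp.sub_apply]

lemma measurable_Hfun (hk : IsEvenKernel k) (q : ℝ) (ρ₀ : Measure E3) (j : Fin 3) :
    Measurable (Hfun k q ρ₀ j) := by
  simp_rw [funext (Hfun_eq k q ρ₀ j)]
  have h1 := hk.measurable_convFn ((measurable_Hfun_aux (qtl k ρ₀ j (1/2 - q))
    (qtl k ρ₀ j (1/2 + q)) (medComp q (marg (mollify k ρ₀) j))).comp (measurable_coord j))
  exact ((h1.add ((measurable_const.sub (hk.measurable_fchi j _)).const_mul _)).add
    ((measurable_const.sub (hk.measurable_fchi j _)).const_mul _)).const_mul _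

lemma exists_abs_Hfun_le (hk : IsEvenKernel k) (q : ℝ) (ρ₀ : Measure E3) (j : Fin 3) :
    ∃ B, ∀ y, |Hfun k q ρ₀ j y| ≤ B := by
  set a := qtl k ρ₀ j (1/2 - q)
  set b := qtl k ρ₀ j (1/2 + q)
  set m := medComp q (marg (mollify k ρ₀) j)
  have h1 := fun y => hk.abs_convFn_le (w := fun x : E3 =>
    (Icc a b).indicator (fun _ => (1:ℝ)) (x j) * (x j - m)) (fun x => abs_Hfun_aux a b m (x j)) y
  refine ⟨|(2 * q * (ρ₀ Set.univ).toReal)⁻¹| * ((|a - m| + |b - m|) + |b - m| * (|1/2 + q| + 1)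
    + |m - a| * (|1/2 - q| + 1)), fun y => ?_⟩
  rw [Hfun_eq, abs_mul]
  refine mul_le_mul_of_nonneg_left ?_ (abs_nonneg _)
  refine (abs_add_le _ _).trans (add_le_add ((abs_add_le _ _).trans (add_le_add (h1 y) ?_)) ?_)
  · rw [abs_mul]
    exact mul_le_mul_of_nonneg_left ((abs_sub _ _).trans
      (add_le_add le_rfl (hk.abs_fchi_le j _ y))) (abs_nonneg _)
  · rw [abs_mul]
    exact mul_le_mul_of_nonneg_left ((abs_sub _ _).trans
      (add_le_add le_rfl (hk.abs_fchi_le j _ y))) (abs_nonneg _)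

lemma integral_Hfun (hk : IsEvenKernel k) (q : ℝ) (ρ₀ : Measure E3) (j : Fin 3)
    (hle : qtl k ρ₀ j (1/2 - q) ≤ qtl k ρ₀ j (1/2 + q)) (ρ : Measure E3) [IsFiniteMeasure ρ] :
    (∫ y, Hfun k q ρ₀ j y ∂ρ) = (2 * q * ρ₀.real univ)⁻¹ *
      (ρ.real univ * (qtl k ρ₀ j (1/2 + q) * (1/2 + q) - qtl k ρ₀ j (1/2 - q) * (1/2 - q)
          - 2 * q * medComp q (marg (mollify k ρ₀) j))
        - ∫ t in qtl k ρ₀ j (1/2 - q)..qtl k ρ₀ j (1/2 + q),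
            (marg (mollify k ρ) j).real (Iic t)) := by
  have := hk.isFiniteMeasure_marg ρ j
  have := nullSingletonClass_marg k ρ j
  simp_rw [Hfun_eq]
  set a := qtl k ρ₀ j (1/2 - q)
  set b := qtl k ρ₀ j (1/2 + q)
  set m := medComp q (marg (mollify k ρ₀) j)
  set ν := marg (mollify k ρ) j
  have hi1 : Integrable (convFn k fun x : E3 =>
      (Icc a b).indicator (fun _ => (1:ℝ)) (x j) * (x j - m)) ρ :=
    hk.integrable_convFn ρ ((measurable_Hfun_aux a b m).comp (measurable_coord j))
    (fun x => abs_Hfun_aux a b m (x j))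
  have hif : ∀ t, Integrable (fchi k j t) ρ := fun t =>
    hk.integrable_convFn ρ (measurable_halfSpaceInd j t) (abs_halfSpaceInd_le j t)
  have hi2 : ∀ c e t, Integrable (fun y => c * (e - fchi k j t y)) ρ := fun c e t =>
    ((integrable_const e).sub (hif t)).const_mul c
  have hv : ∀ c e t, (∫ y, c * (e - fchi k j t y) ∂ρ)
      = c * (e * ρ.real univ - ν.real (Iic t)) := fun c e t => by
    rw [integral_const_mul, integral_sub (integrable_const e) (hif t), integral_const,
      ← hk.marg_real_Iic ρ j t, smul_eq_mul, mul_comm e]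
  have h1 : (∫ y, convFn k (fun x => (Icc a b).indicator (fun _ => (1:ℝ)) (x j) * (x j - m)) y ∂ρ)
      = (∫ s in Icc a b, s ∂ν) - m * (ν.real (Iic b) - ν.real (Iic a)) := by
    rw [← hk.integral_marg ρ j (measurable_Hfun_aux a b m) (abs_Hfun_aux a b m)]
    have : (fun s => (Icc a b).indicator (fun _ => (1:ℝ)) s * (s - m))
        = (Icc a b).indicator (fun s => s - m) := by
      ext s; by_cases hs : s ∈ Icc a b <;> simp [hs]
    have hid : IntegrableOn (fun s : ℝ => s) (Icc a b) ν := continuous_id.integrableOn_Icc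
    rw [this, integral_indicator measurableSet_Icc, integral_sub hid (integrable_const _), setIntegral_const, smul_eq_mul, measureReal_Icc_eq_sub ν hle, mul_comm m]
  have hadd := integral_add (hi1.add (hi2 (b - m) (1/2 + q) b)) (hi2 (m - a) (1/2 - q) a)
  simp only [Pi.add_apply] at hadd
  rw [integral_const_mul, hadd, integral_add hi1 (hi2 _ _ _), hv, hv, h1, setIntegral_Icc_id_eq ν hle]
  change (2 * q * ρ₀.real univ)⁻¹ * _ = _
  ring

end Hfun

end IsEvenKernel

/-- Normalised distribution function of the `j`-th marginal of `k*ρ`. -/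
def margCdf (k : E3 → ℝ) (ρ : Measure E3) (j : Fin 3) (t : ℝ) : ℝ :=
  (marg (mollify k ρ) j).real (Iic t) / ρ.real univ

lemma abs_mass_sub_le_tv (μ ν : Measure E3) [IsFiniteMeasure μ] [IsFiniteMeasure ν] :
    |μ.real univ - ν.real univ| ≤ tv μ ν := by
  simpa using abs_integral_sub_integral_le_tv μ ν (u := fun _ => (1:ℝ)) (B := 1) measurable_const
    (by simp)

lemma abs_div_sub_div_le {F F' M M' d ε : ℝ} (hd : 0 < d) (hM : d ≤ M) (hM' : d ≤ M')
    (hF : 0 ≤ F) (hFM : F ≤ M) (h1 : |F' - F| ≤ ε) (h2 : |M' - M| ≤ ε) :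
    |F' / M' - F / M| ≤ 2 * ε / d := by
  have hM0 := hd.trans_le hM
  have hM0' := hd.trans_le hM'
  have e : F' / M' - F / M = ((F' - F) - (F / M) * (M' - M)) / M' := by field_simp; ring
  have hq : |F / M| ≤ 1 := by
    rw [abs_of_nonneg (by positivity)]
    exact div_le_one_of_le₀ hFM hM0.le
  rw [e, abs_div, abs_of_pos hM0']
  have h3 : |(F' - F) - (F / M) * (M' - M)| ≤ 2 * ε := by
    refine (abs_sub _ _).trans ?_
    rw [abs_mul]
    nlinarith [abs_nonneg (M' - M), abs_nonneg (F / M)]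
  exact div_le_div₀ ((abs_nonneg _).trans h3) h3 hd hM'

lemma clampHalf_one_sub {q : ℝ} (hq : 0 ≤ q) (x : ℝ) : clampHalf q (1 - x) = 1 - clampHalf q x := by
  unfold clampHalf
  rcases le_total (1/2 + q) x with h1 | h1
  · rw [min_eq_left h1, min_eq_right (by linarith), max_eq_left (by linarith),
      max_eq_right (by linarith)]
    ring
  · rcases le_total (1/2 - q) x with h2 | h2
    · rw [min_eq_right h1, min_eq_right (by linarith), max_eq_right (by linarith),
        max_eq_right (by linarith)]
    · rw [min_eq_right h1, min_eq_left (by linarith), max_eq_right (by linarith),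
        max_eq_left (by linarith)]
      ring

namespace IsEvenKernel

variable {k : E3 → ℝ}

lemma marg_real_Iic_le (hk : IsEvenKernel k) (ρ : Measure E3) [IsFiniteMeasure ρ] (j : Fin 3)
    (t : ℝ) : (marg (mollify k ρ) j).real (Iic t) ≤ ρ.real univ := by
  have := hk.isFiniteMeasure_marg ρ j
  rw [← hk.marg_real_univ ρ j]
  exact measureReal_mono (subset_univ _)

lemma abs_marg_real_Iic_sub_le_tv (hk : IsEvenKernel k) (μ ν : Measure E3) [IsFiniteMeasure μ]
    [IsFiniteMeasure ν] (j : Fin 3) (t : ℝ) :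
    |(marg (mollify k μ) j).real (Iic t) - (marg (mollify k ν) j).real (Iic t)| ≤ tv μ ν := by
  rw [hk.marg_real_Iic, hk.marg_real_Iic]
  simpa using abs_integral_sub_integral_le_tv μ ν (hk.measurable_fchi j t) (hk.abs_fchi_le j t)

lemma fchi_convFn_self (hk : IsEvenKernel k) (j : Fin 3) (t : ℝ) (y : E3) :
    fchi (convFn k k) j t y = convFn k (fchi k j t) y :=
  hk.convFn_convFn_self (measurable_halfSpaceInd j t) (abs_halfSpaceInd_le j t) y

lemma abs_marg_real_Iic_sub_le_tvMol (hk : IsEvenKernel k) (μ ν : Measure E3) [IsFiniteMeasure μ]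
    [IsFiniteMeasure ν] (j : Fin 3) (t : ℝ) :
    |(marg (mollify (convFn k k) μ) j).real (Iic t)
      - (marg (mollify (convFn k k) ν) j).real (Iic t)| ≤ tvMol k μ ν := by
  rw [hk.convFn_self.marg_real_Iic, hk.convFn_self.marg_real_Iic]
  simp_rw [hk.fchi_convFn_self]
  simpa using hk.abs_integral_convFn_sub_le μ ν (hk.measurable_fchi j t) (hk.abs_fchi_le j t)

lemma abs_mass_sub_le_tvMol (hk : IsEvenKernel k) (μ ν : Measure E3) [IsFiniteMeasure μ]
    [IsFiniteMeasure ν] : |μ.real univ - ν.real univ| ≤ tvMol k μ ν := by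
  have := hk.abs_integral_convFn_sub_le μ ν (w := fun _ => (1:ℝ)) (B := 1) measurable_const (by simp)
  simp_rw [hk.convFn_const] at this
  simpa using this

lemma monotone_margCdf (hk : IsEvenKernel k) (ρ : Measure E3) [IsFiniteMeasure ρ] (j : Fin 3) :
    Monotone (margCdf k ρ j) := by
  have := hk.isFiniteMeasure_marg ρ j
  exact fun s t hst => div_le_div_of_nonneg_right
    (monotone_measureReal_Iic (marg (mollify k ρ) j) hst) measureReal_nonneg

lemma abs_margCdf_sub_le_tv (hk : IsEvenKernel k) (μ ν : Measure E3) [IsFiniteMeasure μ]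
    [IsFiniteMeasure ν] {d : ℝ} (hd : 0 < d) (hμ : d ≤ μ.real univ) (hν : d ≤ ν.real univ)
    (j : Fin 3) (t : ℝ) : |margCdf k μ j t - margCdf k ν j t| ≤ 2 * tv μ ν / d :=
  abs_div_sub_div_le hd hν hμ measureReal_nonneg (hk.marg_real_Iic_le ν j t)
    (hk.abs_marg_real_Iic_sub_le_tv μ ν j t) (abs_mass_sub_le_tv μ ν)

lemma abs_margCdf_sub_le_tvMol (hk : IsEvenKernel k) (μ ν : Measure E3) [IsFiniteMeasure μ]
    [IsFiniteMeasure ν] {d : ℝ} (hd : 0 < d) (hμ : d ≤ μ.real univ) (hν : d ≤ ν.real univ)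
    (j : Fin 3) (t : ℝ) :
    |margCdf (convFn k k) μ j t - margCdf (convFn k k) ν j t| ≤ 2 * tvMol k μ ν / d :=
  abs_div_sub_div_le hd hν hμ measureReal_nonneg (hk.convFn_self.marg_real_Iic_le ν j t)
    (hk.abs_marg_real_Iic_sub_le_tvMol μ ν j t) (hk.abs_mass_sub_le_tvMol μ ν)

lemma fchi_neg_neg (hk : IsEvenKernel k) (j : Fin 3) (t : ℝ) (y : E3) :
    fchi k j (-t) (-y) = 1 - fchi k j t y := by
  have h1 : fchi k j (-t) (-y) = ∫ z, k z * halfSpaceInd j (-t) (z - y) := by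
    rw [fchi_eq_convFn, convFn, ← integral_neg_eq_self]
    simp_rw [hk.even]
    congr 1; ext z; congr 2; abel
  have h2 : (fun z => k z * halfSpaceInd j (-t) (z - y))
      =ᵐ[volume] fun z => k z - k z * halfSpaceInd j t (y - z) := by
    have h0 : ∀ᵐ z : E3, z j ≠ y j - t := by
      rw [ae_iff]; simpa using volume_coord_eq j (y j - t)
    filter_upwards [h0] with z hz
    simp only [halfSpaceInd, PiLp.sub_apply, indicator, mem_Iic]
    rcases lt_or_gt_of_ne hz with h | h
    · rw [if_pos (by linarith), if_neg (by linarith)]; ring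
    · rw [if_neg (by linarith), if_pos (by linarith)]; ring
  rw [h1, integral_congr_ae h2, integral_sub hk.integrable
    (hk.integrable_mul_comp_sub (measurable_halfSpaceInd j t) (abs_halfSpaceInd_le j t) y),
    hk.integral_one]
  rfl

lemma margCdf_neg (hk : IsEvenKernel k) (ρ : Measure E3) [IsFiniteMeasure ρ]
    (hM : 0 < ρ.real univ) (hρ : ρ.map (fun y => -y) = ρ) (j : Fin 3) (t : ℝ) :
    margCdf k ρ j (-t) = 1 - margCdf k ρ j t := by
  have h1 : (∫ y, fchi k j (-t) y ∂ρ) = ρ.real univ - ∫ y, fchi k j t y ∂ρ := by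
    conv_lhs => rw [← hρ]
    rw [integral_map measurable_neg.aemeasurable (hk.measurable_fchi j _).aestronglyMeasurable]
    simp_rw [hk.fchi_neg_neg]
    have hi : Integrable (fchi k j t) ρ :=
      hk.integrable_convFn ρ (measurable_halfSpaceInd j t) (abs_halfSpaceInd_le j t)
    rw [integral_sub (integrable_const _) hi]
    simp
  unfold margCdf
  rw [hk.marg_real_Iic, hk.marg_real_Iic, h1]
  field_simp

lemma medComp_eq_zero (hk : IsEvenKernel k) (ρ : Measure E3) [IsFiniteMeasure ρ]
    (hM : 0 < ρ.real univ) (hρ : ρ.map (fun y => -y) = ρ) (j : Fin 3) {q A : ℝ} (hq : 0 < q)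
    (hlo : (marg (mollify k ρ) j).real (Iic (-A)) ≤ (1/2 - q) * ρ.real univ)
    (hhi : (1/2 + q) * ρ.real univ < (marg (mollify k ρ) j).real (Iic A)) :
    medComp q (marg (mollify k ρ) j) = 0 := by
  have := hk.isFiniteMeasure_marg ρ j
  have := nullSingletonClass_marg k ρ j
  have hu := hk.marg_real_univ ρ j
  have h := medComp_eq_integral (marg (mollify k ρ) j) (q := q) (A := A) (by rwa [hu]) hq
    (by rwa [hu]) (by rwa [hu])
  rw [hu] at h
  change _ = ∫ t in (-A)..A, (1/2 - clampHalf q (margCdf k ρ j t)) at h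
  have hodd : (∫ t in (-A)..A, (1/2 - clampHalf q (margCdf k ρ j t)))
      = - ∫ t in (-A)..A, (1/2 - clampHalf q (margCdf k ρ j t)) := by
    rw [← intervalIntegral.integral_neg]
    have := intervalIntegral.integral_comp_neg (a := -A) (b := A)
      (fun t => 1/2 - clampHalf q (margCdf k ρ j t))
    rw [neg_neg] at this
    rw [← this]
    congr 1; ext t
    rw [hk.margCdf_neg ρ hM hρ, clampHalf_one_sub hq.le]
    ring
  have : 2 * q * medComp q (marg (mollify k ρ) j) = 0 := by linarith
  simpa [hq.ne'] using this

end IsEvenKernel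

section Growth

variable {g : E3 → ℝ} {h ℓ : ℝ}

lemma fchi_eq_line (g : E3 → ℝ) (j : Fin 3) (t : ℝ) (y : E3) :
    fchi g j t y = fchi g j 0 ((y j - t) • esingle j) := by
  unfold fchi
  congr 1; ext z
  have : ((y j - t) • esingle j : E3) j = y j - t := by simp [esingle]
  rw [this]
  simp only [indicator, mem_Iic]
  have e : y j - z j ≤ t ↔ y j - t - z j ≤ 0 := by constructor <;> intro h <;> linarith
  simp only [e]

lemma Adapted.le_fchi_sub (hg : Adapted g h ℓ) (hh : 0 < h) (j : Fin 3) {t₁ t₂ : ℝ} {y : E3}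
    (h12 : t₁ ≤ t₂) (h1 : |y j - t₁| < 2 * ℓ) (h2 : |y j - t₂| < 2 * ℓ) :
    h * (t₂ - t₁) ≤ fchi g j t₂ y - fchi g j t₁ y := by
  have hd : ∀ s ∈ Ioo (-(2*ℓ)) (2*ℓ), ∃ c, c ≤ -h ∧
      HasDerivAt (fun s : ℝ => fchi g j 0 (s • esingle j)) c s := fun s hs => by
    have := hg j 0 (s • esingle j)
    have e : ((s • esingle j : E3)) j = s := by simp [esingle]
    rw [e, zero_sub, zero_add, indicator_of_mem hs, mul_one] at this
    refine ⟨fderiv ℝ (fchi g j 0) (s • esingle j) (esingle j), by linarith, ?_⟩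
    have hdiff : DifferentiableAt ℝ (fchi g j 0) (s • esingle j) := by
      by_contra hn
      rw [fderiv_zero_of_not_differentiableAt hn] at this
      simp at this
      linarith
    have hl : HasDerivAt (fun s : ℝ => s • esingle j) (esingle j) s := by
      simpa using (hasDerivAt_id s).smul_const (esingle j)
    exact hdiff.hasFDerivAt.comp_hasDerivAt s hl
  choose! c hc hcd using hd
  rw [abs_lt] at h1 h2
  have := (convex_Ioo (-(2*ℓ)) (2*ℓ)).image_sub_le_mul_sub_of_deriv_le
    (f := fun s : ℝ => fchi g j 0 (s • esingle j)) (C := -h)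
    (fun s hs => (hcd s hs).continuousAt.continuousWithinAt)
    (fun s hs => (hcd s (interior_subset hs)).differentiableAt.differentiableWithinAt)
    (fun s hs => by rw [(hcd s (interior_subset hs)).deriv]; exact hc s (interior_subset hs))
    (y j - t₂) ⟨by linarith, by linarith⟩ (y j - t₁) ⟨by linarith, by linarith⟩ (by linarith)
  rw [fchi_eq_line g j t₂, fchi_eq_line g j t₁]
  linarith

lemma halfSpaceInd_of_le {j : Fin 3} {t : ℝ} {y : E3} (h : y j ≤ t) : halfSpaceInd j t y = 1 :=
  indicator_of_mem (s := Iic t) h _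

lemma halfSpaceInd_of_lt {j : Fin 3} {t : ℝ} {y : E3} (h : t < y j) : halfSpaceInd j t y = 0 :=
  indicator_of_notMem (s := Iic t) (notMem_Iic.2 h) _

lemma halfSpaceInd_mono (j : Fin 3) {t₁ t₂ : ℝ} (h12 : t₁ ≤ t₂) (y : E3) :
    halfSpaceInd j t₁ y ≤ halfSpaceInd j t₂ y :=
  indicator_le_indicator_of_subset (Iic_subset_Iic.2 h12) (fun _ => zero_le_one) _

lemma IsEvenKernel.fchi_mono (hk : IsEvenKernel g) (j : Fin 3) {t₁ t₂ : ℝ} (h12 : t₁ ≤ t₂)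
    (y : E3) : fchi g j t₁ y ≤ fchi g j t₂ y :=
  hk.convFn_mono (measurable_halfSpaceInd j _) (abs_halfSpaceInd_le j _)
    (measurable_halfSpaceInd j _) (abs_halfSpaceInd_le j _)
    fun _ _ => halfSpaceInd_mono j h12 _

lemma Adapted.le_fchi_convFn_sub (hg : Adapted g h ℓ) (hk : IsEvenKernel g) (hh : 0 < h)
    (hℓ : 0 < ℓ) (j : Fin 3) {t₁ t₂ : ℝ} {y : E3} (h12 : t₁ ≤ t₂)
    (h1 : |y j - t₁| < 3/2 * ℓ) (h2 : |y j - t₂| < 3/2 * ℓ) :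
    h^2 * ℓ * (t₂ - t₁) ≤ fchi (convFn g g) j t₂ y - fchi (convFn g g) j t₁ y := by
  have hi := fun t => hk.integrable_mul_comp_sub (hk.measurable_fchi j t) (hk.abs_fchi_le j t) y
  have hi' := fun t => hk.integrable_mul_comp_sub (measurable_halfSpaceInd j t)
    (abs_halfSpaceInd_le j t) y
  have hw := hg.le_fchi_sub hh j (t₁ := y j - ℓ/2) (t₂ := y j + ℓ/2) (y := y) (by linarith)
    (by rw [abs_lt]; constructor <;> linarith) (by rw [abs_lt]; constructor <;> linarith)
  rw [hk.fchi_convFn_self, hk.fchi_convFn_self]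
  have hmain : h * (t₂ - t₁) * (fchi g j (y j + ℓ/2) y - fchi g j (y j - ℓ/2) y)
      ≤ convFn g (fchi g j t₂) y - convFn g (fchi g j t₁) y := by
    unfold convFn
    rw [fchi_eq_convFn, fchi_eq_convFn, convFn, convFn, ← integral_sub (hi' _) (hi' _),
      ← integral_sub (hi _) (hi _), ← integral_const_mul]
    refine integral_mono (((hi' _).sub (hi' _)).const_mul _) ((hi _).sub (hi _)) fun z => ?_
    have hz := hk.nonneg z
    change h * (t₂ - t₁) * (g z * halfSpaceInd j (y j + ℓ/2) (y - z)
      - g z * halfSpaceInd j (y j - ℓ/2) (y - z))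
      ≤ g z * fchi g j t₂ (y - z) - g z * fchi g j t₁ (y - z)
    suffices h * (t₂ - t₁) * (halfSpaceInd j (y j + ℓ/2) (y - z)
        - halfSpaceInd j (y j - ℓ/2) (y - z)) ≤ fchi g j t₂ (y - z) - fchi g j t₁ (y - z) by
      nlinarith
    have hm := hk.fchi_mono j h12 (y - z)
    have hyz : (y - z) j = y j - z j := rfl
    rw [abs_lt] at h1 h2
    by_cases hb : (y - z) j ≤ y j - ℓ/2
    · rw [halfSpaceInd_of_le hb, halfSpaceInd_of_le (hb.trans (by linarith))]
      linarith
    · by_cases ha : (y - z) j ≤ y j + ℓ/2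
      · rw [halfSpaceInd_of_lt (not_le.1 hb), halfSpaceInd_of_le ha, sub_zero, mul_one]
        push Not at hb
        exact hg.le_fchi_sub hh j h12 (by rw [abs_lt]; constructor <;> linarith)
          (by rw [abs_lt]; constructor <;> linarith)
      · rw [halfSpaceInd_of_lt (not_le.1 hb), halfSpaceInd_of_lt (not_le.1 ha)]
        linarith
  have : 0 ≤ h * (t₂ - t₁) := mul_nonneg hh.le (by linarith)
  nlinarith

lemma Adapted.le_marg_real_sub (hg : Adapted g h ℓ) (hk : IsEvenKernel g) (hh : 0 < h)
    (hℓ : 0 < ℓ) (ρ : Measure E3) [IsFiniteMeasure ρ] (j : Fin 3) {x β : ℝ}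
    (hβ : β ≤ ρ.real {y : E3 | |y j - x| ≤ ℓ}) {t₁ t₂ : ℝ} (h12 : t₁ ≤ t₂)
    (h1 : |t₁ - x| ≤ ℓ/4) (h2 : |t₂ - x| ≤ ℓ/4) :
    β * (h^2 * ℓ) * (t₂ - t₁) ≤ (marg (mollify (convFn g g) ρ) j).real (Iic t₂)
      - (marg (mollify (convFn g g) ρ) j).real (Iic t₁) := by
  have hk' := hk.convFn_self
  set S := {y : E3 | |y j - x| ≤ ℓ}
  have hS : MeasurableSet S :=
    measurableSet_le (((measurable_coord j).sub_const x).abs) measurable_const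
  have hif : ∀ t, Integrable (fchi (convFn g g) j t) ρ := fun t =>
    hk'.integrable_convFn ρ (measurable_halfSpaceInd j t) (abs_halfSpaceInd_le j t)
  have hc : 0 ≤ h^2 * ℓ * (t₂ - t₁) := mul_nonneg (by positivity) (by linarith)
  rw [hk'.marg_real_Iic, hk'.marg_real_Iic, ← integral_sub (hif _) (hif _)]
  calc β * (h^2 * ℓ) * (t₂ - t₁) ≤ ρ.real S * (h^2 * ℓ * (t₂ - t₁)) := by nlinarith
    _ = ∫ y, S.indicator (fun _ => h^2 * ℓ * (t₂ - t₁)) y ∂ρ := by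
      rw [integral_indicator hS, setIntegral_const, smul_eq_mul]
    _ ≤ _ := by
      refine integral_mono ((integrable_const _).indicator hS) ((hif _).sub (hif _)) fun y => ?_
      change _ ≤ fchi (convFn g g) j t₂ y - fchi (convFn g g) j t₁ y
      by_cases hy : y ∈ S
      · rw [indicator_of_mem hy]
        have hy' : |y j - x| ≤ ℓ := hy
        rw [abs_le] at hy' h1 h2
        exact hg.le_fchi_convFn_sub hk hh hℓ j h12 (by rw [abs_lt]; constructor <;> linarith)
          (by rw [abs_lt]; constructor <;> linarith)
      · rw [indicator_of_notMem hy]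
        exact sub_nonneg.2 (hk'.fchi_mono j h12 y)

/-- A monotone function with slope at least `c` on `[x - r, x + r]` grows at least linearly away
from `x` on every bounded interval. -/
lemma mul_abs_sub_le_of_slope {F : ℝ → ℝ} (hF : Monotone F) {c r A x : ℝ} (hc : 0 < c) (hr : 0 < r)
    (hA : 0 < A) (hx : x ∈ Icc (-A) A)
    (hs : ∀ t₁ t₂, t₁ ≤ t₂ → |t₁ - x| ≤ r → |t₂ - x| ≤ r → c * (t₂ - t₁) ≤ F t₂ - F t₁)
    {t : ℝ} (ht : t ∈ Icc (-A) A) : c * min 1 (r / (2 * A)) * |t - x| ≤ |F t - F x| := by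
  have hmin : min 1 (r / (2 * A)) * |t - x| ≤ min |t - x| r := by
    have h2A : |t - x| ≤ 2 * A := by rw [abs_le]; constructor <;> linarith [ht.1, ht.2, hx.1, hx.2]
    refine le_min ?_ ?_
    · exact (mul_le_mul_of_nonneg_right (min_le_left _ _) (abs_nonneg _)).trans (one_mul _).le
    · calc _ ≤ r / (2 * A) * (2 * A) :=
            mul_le_mul (min_le_right _ _) h2A (abs_nonneg _) (by positivity)
        _ = r := by field_simp
  have hmn : 0 ≤ min |t - x| r := le_min (abs_nonneg _) hr.le
  suffices c * min |t - x| r ≤ |F t - F x| by nlinarith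
  have e0 : |x - x| ≤ r := by simpa using hr.le
  rcases le_total x t with hxt | hxt
  · rw [abs_of_nonneg (sub_nonneg.2 (hF hxt))]
    have e : |t - x| = t - x := abs_of_nonneg (by linarith)
    have h1 := hs x (x + min |t - x| r) (by linarith) e0
      (by rw [add_sub_cancel_left, abs_of_nonneg hmn]; exact min_le_right _ _)
    have h2 : F (x + min |t - x| r) ≤ F t := hF (by linarith [min_le_left |t - x| r])
    linarith
  · rw [abs_of_nonpos (sub_nonpos.2 (hF hxt))]
    have e : |t - x| = x - t := by rw [abs_of_nonpos (by linarith)]; ring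
    have h1 := hs (x - min |t - x| r) x (by linarith)
      (by rw [sub_sub_cancel_left, abs_neg, abs_of_nonneg hmn]; exact min_le_right _ _) e0
    have h2 : F t ≤ F (x - min |t - x| r) := hF (by linarith [min_le_left |t - x| r])
    linarith

end Growth

section Concentration

/-- A finite measure with small pair correlation concentrates in a ball. -/
lemma exists_measureReal_compl_ball_lt (ν : Measure E3) [IsFiniteMeasure ν] {d δ R : ℝ} (hd : 0 < d)
    (hR : 0 < R) (hδ0 : 0 < δ) (hδ : δ < d^2/2) (hdM : d ≤ ν.real univ)
    (hpair : ((ν.prod ν) {p : E3 × E3 | R < dist p.1 p.2}).toReal ≤ δ) :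
    ∃ y, ν.real {x | 2 * R < dist x y} < δ / ν.real univ := by
  set M := ν.real univ
  set s := δ / M
  have hM : 0 < M := hd.trans_le hdM
  have hs : 0 < s := by positivity
  have hsM : s * M = δ := by simp only [s]; field_simp
  have h2s : 2 * s < M := by
    have : 2 * (s * M) < M * M := by nlinarith
    nlinarith
  by_contra! hcon
  set S := {p : E3 × E3 | R < dist p.1 p.2}
  have hS : MeasurableSet S := measurableSet_lt measurable_const (by fun_prop)
  set N : E3 → ℝ := fun x => ν.real (Prod.mk x ⁻¹' S)
  have hNm : Measurable N := (measurable_measure_prodMk_left hS).ennreal_toReal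
  have hNi : Integrable N ν := Integrable.of_bound (C := M) hNm.aestronglyMeasurable
    (ae_of_all _ fun x => by
      rw [Real.norm_of_nonneg measureReal_nonneg]
      exact measureReal_mono (subset_univ _))
  have hNint : (∫ x, N x ∂ν) ≤ δ := by
    have : (∫ x, N x ∂ν) = ((ν.prod ν) S).toReal := by
      rw [Measure.prod_apply hS]
      exact integral_toReal (measurable_measure_prodMk_left hS).aemeasurable
        (ae_of_all _ fun x => measure_lt_top _ _)
    rwa [this]
  have hν : ν ≠ 0 := by
    rintro rfl
    simp [M] at hM
  obtain ⟨y₁, hy₁⟩ := exists_le_average hν hNi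
  have hy₁s : N y₁ ≤ s := by
    refine hy₁.trans ?_
    rw [average_eq, smul_eq_mul, inv_mul_eq_div]
    exact div_le_div_of_nonneg_right hNint hM.le
  set O := {x | 2 * R < dist x y₁}
  have hO : MeasurableSet O := measurableSet_lt measurable_const (by fun_prop)
  have hlow : ∀ x, s + O.indicator (fun _ => M - 2 * s) x ≤ N x := fun x => by
    by_cases hx : x ∈ O
    · rw [indicator_of_mem hx]
      have hsub : (Prod.mk y₁ ⁻¹' S)ᶜ ⊆ Prod.mk x ⁻¹' S := fun z hz => by
        have hz' : dist y₁ z ≤ R := not_lt.1 hz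
        have hx' : 2 * R < dist x y₁ := hx
        change R < dist x z
        linarith [dist_triangle x z y₁, dist_comm z y₁]
      have h1 : ν.real (Prod.mk y₁ ⁻¹' S)ᶜ = M - N y₁ :=
        measureReal_compl (measurable_prodMk_left hS)
      have h2 : ν.real (Prod.mk y₁ ⁻¹' S)ᶜ ≤ N x := measureReal_mono hsub
      linarith
    · rw [indicator_of_notMem hx, add_zero]
      refine (hcon x).trans (measureReal_mono fun z hz => ?_)
      have hz' : 2 * R < dist z x := hz
      change R < dist x z
      linarith [dist_comm x z]
  have hi := integral_mono ((integrable_const s).add ((integrable_const (M - 2*s)).indicator hO)) hNi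
    hlow
  have hadd := integral_add (μ := ν) (integrable_const s) ((integrable_const (M - 2*s)).indicator hO)
  rw [integral_indicator hO, setIntegral_const, integral_const, smul_eq_mul, smul_eq_mul] at hadd
  have hi' : M * s + ν.real O * (M - 2 * s) ≤ ∫ x, N x ∂ν := hadd ▸ hi
  have := hcon y₁
  have : s * (M - 2 * s) ≤ ν.real O * (M - 2 * s) :=
    mul_le_mul_of_nonneg_right (hcon y₁) (by linarith)
  have : 0 < s * (M - 2 * s) := mul_pos hs (by linarith)
  linarith

lemma medComp_mem_Icc (ν : Measure ℝ) [IsFiniteMeasure ν] (hM : 0 < ν.real univ) {q qt c e : ℝ}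
    (hqt : 0 < qt) (hqq : qt ≤ q) (hI : ν.real (Icc c e)ᶜ < (1/2 - q) * ν.real univ) :
    medComp qt ν ∈ Icc c e := by
  set M := ν.real univ
  have hlow : ∀ u < c, ν.real (Iic u) < (1/2 - q) * M := fun u hu =>
    (measureReal_mono (s₁ := Iic u) (s₂ := (Icc c e)ᶜ)
      fun _ hx hx' => not_le.2 hu (hx'.1.trans hx)).trans_lt hI
  have hup : (1/2 + q) * M < ν.real (Iic e) := by
    have h1 : ν.real (Iic e)ᶜ = M - ν.real (Iic e) := measureReal_compl measurableSet_Iic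
    have h2 : ν.real (Iic e)ᶜ ≤ ν.real (Icc c e)ᶜ :=
      measureReal_mono (compl_subset_compl.2 Icc_subset_Iic_self)
    linarith
  have hmul : qt * M ≤ q * M := mul_le_mul_of_nonneg_right hqq hM.le
  have hspec1 := fun u (hu : u < c) => quantile_spec ν (lam := 1/2 - qt) (u := u) (v := e)
    (by linarith [hlow u hu]) (by nlinarith)
  have hspec2 := fun u (hu : u < c) => quantile_spec ν (lam := 1/2 + qt) (u := u) (v := e)
    (by nlinarith [hlow u hu]) (by nlinarith)
  obtain ⟨-, h1e, h1lo, -⟩ := hspec1 (c - 1) (by linarith)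
  obtain ⟨-, h2e, -, h2hi⟩ := hspec2 (c - 1) (by linarith)
  have hc : c ≤ quantile ν (1/2 - qt) := le_of_forall_lt fun u hu => by
    obtain ⟨w, huw, hwc⟩ := exists_between hu
    exact huw.trans_le (hspec1 w hwc).1
  set a := quantile ν (1/2 - qt)
  set b := quantile ν (1/2 + qt)
  have hK : 0 < ν.real (Icc a b) := by
    have h3 : ν.real (Iic b) ≤ ν.real (Iio a) + ν.real (Icc a b) := by
      refine (measureReal_mono (fun x hx => ?_)).trans (measureReal_union_le _ _)
      rcases lt_or_ge x a with hxa | hxa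
      · exact Or.inl hxa
      · exact Or.inr ⟨hxa, hx⟩
    nlinarith
  have hid : IntegrableOn (fun t : ℝ => t) (Icc a b) ν := continuous_id.integrableOn_Icc
  change (∫ t in Icc a b, t ∂ν) / ν.real (Icc a b) ∈ Icc c e
  constructor
  · rw [le_div_iff₀ hK]
    have := setIntegral_mono_on (integrable_const c).integrableOn hid measurableSet_Icc
      fun x hx => hc.trans hx.1
    rwa [setIntegral_const, smul_eq_mul, mul_comm] at this
  · rw [div_le_iff₀ hK]
    have := setIntegral_mono_on hid (integrable_const e).integrableOn measurableSet_Icc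
      fun x hx => hx.2.trans h2e
    rwa [setIntegral_const, smul_eq_mul, mul_comm] at this

lemma abs_coord_le_norm (y : E3) (j : Fin 3) : |y j| ≤ ‖y‖ := by
  simpa using PiLp.norm_apply_le y j

namespace IsEvenKernel

variable {k : E3 → ℝ}

lemma exists_support_le (hk : IsEvenKernel k) : ∃ r, 0 < r ∧ ∀ z, k z ≠ 0 → ‖z‖ ≤ r := by
  obtain ⟨r, hr, hs⟩ := hk.compactSupport.isCompact.isBounded.subset_closedBall_lt 0 0
  exact ⟨r, hr, fun z hz => by simpa using hs (subset_tsupport _ hz)⟩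

lemma fchi_le_halfSpaceInd (hk : IsEvenKernel k) {r : ℝ} (hr : ∀ z, k z ≠ 0 → ‖z‖ ≤ r) (j : Fin 3)
    (t : ℝ) (y : E3) : fchi k j t y ≤ halfSpaceInd j (t + r) y := by
  rw [← hk.convFn_const (halfSpaceInd j (t + r) y) y]
  refine hk.convFn_mono (measurable_halfSpaceInd j t) (abs_halfSpaceInd_le j t) measurable_const
    (fun _ => abs_halfSpaceInd_le j (t + r) y) fun z hz => ?_
  have hz' := (abs_le.1 ((abs_coord_le_norm z j).trans (hr z hz)))
  have hyz : (y - z) j = y j - z j := rfl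
  by_cases hy : (y - z) j ≤ t
  · rw [halfSpaceInd_of_le (show y j ≤ t + r by linarith)]
    exact halfSpaceInd_le_one _ _ _
  · rw [halfSpaceInd_of_lt (not_le.1 hy)]
    exact halfSpaceInd_nonneg _ _ _

lemma halfSpaceInd_le_fchi (hk : IsEvenKernel k) {r : ℝ} (hr : ∀ z, k z ≠ 0 → ‖z‖ ≤ r) (j : Fin 3)
    (t : ℝ) (y : E3) : halfSpaceInd j (t - r) y ≤ fchi k j t y := by
  rw [← hk.convFn_const (halfSpaceInd j (t - r) y) y]
  refine hk.convFn_mono measurable_const (fun _ => abs_halfSpaceInd_le j (t - r) y)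
    (measurable_halfSpaceInd j t) (abs_halfSpaceInd_le j t) fun z hz => ?_
  have hz' := (abs_le.1 ((abs_coord_le_norm z j).trans (hr z hz)))
  have hyz : (y - z) j = y j - z j := rfl
  by_cases hy : y j ≤ t - r
  · rw [halfSpaceInd_of_le (show (y - z) j ≤ t by linarith)]
    exact halfSpaceInd_le_one _ _ _
  · rw [halfSpaceInd_of_lt (not_le.1 hy)]
    exact halfSpaceInd_nonneg _ _ _

lemma integral_halfSpaceInd (ρ : Measure E3) (j : Fin 3) (t : ℝ) :
    (∫ y, halfSpaceInd j t y ∂ρ) = ρ.real {y | y j ≤ t} := by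
  have h : MeasurableSet {y : E3 | y j ≤ t} := measurableSet_le (measurable_coord j) measurable_const
  have : halfSpaceInd j t = {y : E3 | y j ≤ t}.indicator fun _ => (1:ℝ) := rfl
  rw [this, integral_indicator h, setIntegral_const, smul_eq_mul, mul_one]

lemma integrable_halfSpaceInd (ρ : Measure E3) [IsFiniteMeasure ρ] (j : Fin 3) (t : ℝ) :
    Integrable (halfSpaceInd j t) ρ :=
  Integrable.of_bound (C := 1) (measurable_halfSpaceInd j t).aestronglyMeasurable
    (ae_of_all _ fun y => abs_halfSpaceInd_le j t y)

lemma marg_bracket (hk : IsEvenKernel k) {r : ℝ} (hr : ∀ z, k z ≠ 0 → ‖z‖ ≤ r)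
    (ν : Measure E3) [IsFiniteMeasure ν] {c : E3} {R q A : ℝ} (j : Fin 3)
    (hc : ν.real {x | 2 * R < dist x c} < (1/2 - q) * ν.real univ)
    (hA : |c j| + 2 * R + r < A) :
    (marg (mollify k ν) j).real (Iic (-A)) ≤ (1/2 - q) * ν.real univ ∧
      (1/2 + q) * ν.real univ < (marg (mollify k ν) j).real (Iic A) := by
  have hif : ∀ t, Integrable (fchi k j t) ν := fun t =>
    hk.integrable_convFn ν (measurable_halfSpaceInd j t) (abs_halfSpaceInd_le j t)
  have hcj := abs_le.1 (le_refl |c j|)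
  have hd : ∀ x : E3, |x j - c j| ≤ dist x c := fun x => by
    rw [dist_eq_norm]; exact abs_coord_le_norm (x - c) j
  rw [hk.marg_real_Iic, hk.marg_real_Iic]
  constructor
  · have h1 := integral_mono (hif (-A)) (integrable_halfSpaceInd ν j (-A + r))
      (hk.fchi_le_halfSpaceInd hr j (-A))
    rw [integral_halfSpaceInd] at h1
    refine (h1.trans (measureReal_mono fun x hx => ?_)).trans hc.le
    have hx' : x j ≤ -A + r := hx
    have := (abs_le.1 (hd x)).1
    change 2 * R < dist x c
    linarith
  · have h1 := integral_mono (integrable_halfSpaceInd ν j (A - r)) (hif A)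
      (hk.halfSpaceInd_le_fchi hr j A)
    rw [integral_halfSpaceInd] at h1
    have hm : MeasurableSet {y : E3 | y j ≤ A - r} :=
      measurableSet_le (measurable_coord j) measurable_const
    have h2 : ν.real {y : E3 | y j ≤ A - r}ᶜ = ν.real univ - ν.real {y : E3 | y j ≤ A - r} :=
      measureReal_compl hm
    have h3 : ν.real {y : E3 | y j ≤ A - r}ᶜ ≤ ν.real {x | 2 * R < dist x c} :=
      measureReal_mono fun x hx => by
        have hx' : A - r < x j := not_le.1 hx
        have := (abs_le.1 (hd x)).2
        change 2 * R < dist x c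
        linarith
    linarith

lemma exists_marg_bracket (hk : IsEvenKernel k) {q d D δ R R' : ℝ}
    (hd : 0 < d) (hδ0 : 0 < δ) (hR : 0 < R) (hR' : 0 < R') (hδ : δ < d^2/2) (hqδ : q ≤ 1/2 - δ/d^2) (ρ₀ : Measure E3) [IsFiniteMeasure ρ₀]
    (h0 : MassCond d D δ R ρ₀) :
    ∃ A > 0, ∀ (ν : Measure E3) [IsFiniteMeasure ν], MassCond d D δ R ν →
      ∀ qt, 0 < qt → qt ≤ q → ‖med qt ν - med qt ρ₀‖ ≤ R' → ∀ j,
      (marg (mollify k ν) j).real (Iic (-A)) ≤ (1/2 - q) * ν.real univ ∧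
        (1/2 + q) * ν.real univ < (marg (mollify k ν) j).real (Iic A) := by
  have hcenter : ∀ (ν : Measure E3) [IsFiniteMeasure ν], MassCond d D δ R ν →
      ∃ c : E3, ν.real {x | 2 * R < dist x c} < (1/2 - q) * ν.real univ ∧
        ∀ qt, 0 < qt → qt ≤ q → ∀ j, |medComp qt (marg ν j) - c j| ≤ 2 * R := fun ν _ hν => by
    obtain ⟨c, hc⟩ := exists_measureReal_compl_ball_lt ν hd hR hδ0 hδ hν.1 hν.2.2
    have hM : d ≤ ν.real univ := hν.1
    have hM0 := hd.trans_le hM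
    have hc' : ν.real {x | 2 * R < dist x c} < (1/2 - q) * ν.real univ := by
      refine hc.trans_le ?_
      rw [div_le_iff₀ hM0]
      have h1 : δ / d^2 ≤ 1/2 - q := by linarith
      have h2 : d^2 ≤ ν.real univ * ν.real univ := by nlinarith
      calc δ = δ / d^2 * d^2 := by field_simp
        _ ≤ (1/2 - q) * (ν.real univ * ν.real univ) :=
          mul_le_mul h1 h2 (by positivity) (le_trans (by positivity) h1)
        _ = _ := by ring
    refine ⟨c, hc', fun qt hqt hqq j => ?_⟩
    have hfin : IsFiniteMeasure (marg ν j) := by unfold marg; infer_instance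
    have hu : (marg ν j).real univ = ν.real univ := by
      rw [marg, map_measureReal_apply (measurable_coord j) MeasurableSet.univ, preimage_univ]
    have hm := medComp_mem_Icc (marg ν j) (by rwa [hu]) (c := c j - 2 * R) (e := c j + 2 * R)
      hqt hqq (by
        rw [hu, marg, map_measureReal_apply (measurable_coord j) measurableSet_Icc.compl]
        refine (measureReal_mono fun x hx => ?_).trans_lt hc'
        by_contra hn
        have hn' : dist x c ≤ 2 * R := not_lt.1 hn
        rw [dist_eq_norm] at hn'
        have := abs_le.1 ((abs_coord_le_norm (x - c) j).trans hn')
        have e : (x - c) j = x j - c j := rfl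
        exact hx ⟨by linarith [this.1], by linarith [this.2]⟩)
    rw [abs_le]
    constructor <;> linarith [hm.1, hm.2]
  obtain ⟨r, hr0, hr⟩ := hk.exists_support_le
  obtain ⟨c₀, -, hc₀⟩ := hcenter ρ₀ h0
  refine ⟨‖c₀‖ + R' + 6 * R + r + 1, by positivity, fun ν _ hν qt hqt hqq hmed j => ?_⟩
  obtain ⟨c, hc, hcm⟩ := hcenter ν hν
  refine hk.marg_bracket hr ν j hc ?_
  have h1 := hcm qt hqt hqq j
  have h2 := hc₀ qt hqt hqq j
  have h3 : |medComp qt (marg ν j) - medComp qt (marg ρ₀ j)| ≤ R' :=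
    (abs_coord_le_norm (med qt ν - med qt ρ₀) j).trans hmed
  have h4 := abs_coord_le_norm c₀ j
  rw [abs_le] at h1 h2 h3 h4
  have : |c j| ≤ ‖c₀‖ + R' + 4 * R := by rw [abs_le]; constructor <;> linarith
  linarith

end IsEvenKernel

end Concentration

section MedianExpansion

lemma abs_sub_expansion_le {F F' F₀ M M' M₀ d τ ε : ℝ} (hd : 0 < d) (hM : d ≤ M) (hM' : d ≤ M')
    (hM₀ : d ≤ M₀) (hF₀ : 0 ≤ F₀) (hFM₀ : F₀ ≤ M₀)
    (hFF : |F' - F| ≤ τ) (hMM : |M' - M| ≤ τ) (hFF₀ : |F / M - F₀ / M₀| ≤ 2 * ε / d)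
    (hMM₀ : |M - M₀| ≤ ε) :
    |(F / M - F' / M') - (F₀ / M₀ * (M' - M) - (F' - F)) / M₀| ≤ 4 * τ * (τ + ε) / d^2 := by
  have hM0 := hd.trans_le hM
  have hM0' := hd.trans_le hM'
  have hM00 := hd.trans_le hM₀
  have hτ : 0 ≤ τ := (abs_nonneg _).trans hFF
  have hε : 0 ≤ ε := (abs_nonneg _).trans hMM₀
  have hinv : |1 / M' - 1 / M₀| ≤ (τ + ε) / d^2 := by
    have e : 1 / M' - 1 / M₀ = (M₀ - M') / (M' * M₀) := by field_simp
    rw [e, abs_div, abs_of_pos (by positivity : 0 < M' * M₀)]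
    have : |M₀ - M'| ≤ τ + ε := by
      rw [abs_le] at hMM hMM₀ ⊢
      constructor <;> linarith
    exact div_le_div₀ (by positivity) this (by positivity) (by nlinarith)
  have hφ₀ : |F₀ / M₀| ≤ 1 := by
    rw [abs_of_nonneg (by positivity)]
    exact div_le_one_of_le₀ hFM₀ hM00.le
  have h2 : |F / M / M' - F₀ / M₀ / M₀| ≤ 3 * (τ + ε) / d^2 := by
    have e : F / M / M' - F₀ / M₀ / M₀
        = (F / M - F₀ / M₀) / M' + F₀ / M₀ * (1 / M' - 1 / M₀) := by ring
    have e1 : |(F / M - F₀ / M₀) / M'| ≤ 2 * ε / d^2 := by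
      rw [abs_div, abs_of_pos hM0']
      calc _ ≤ (2 * ε / d) / d := div_le_div₀ (by positivity) hFF₀ hd hM'
        _ = _ := by field_simp
    have e2 : |F₀ / M₀ * (1 / M' - 1 / M₀)| ≤ (τ + ε) / d^2 := by
      rw [abs_mul]
      exact (mul_le_mul hφ₀ hinv (abs_nonneg _) zero_le_one).trans (one_mul _).le
    rw [e]
    refine (abs_add_le _ _).trans ((add_le_add e1 e2).trans ?_)
    rw [← add_div]
    exact div_le_div_of_nonneg_right (by linarith) (by positivity)
  have e : (F / M - F' / M') - (F₀ / M₀ * (M' - M) - (F' - F)) / M₀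
      = (F - F') * (1 / M' - 1 / M₀) + (M' - M) * (F / M / M' - F₀ / M₀ / M₀) := by
    field_simp
    ring
  rw [e]
  refine (abs_add_le _ _).trans ?_
  rw [abs_mul, abs_mul, abs_sub_comm F F']
  calc _ ≤ τ * ((τ + ε) / d^2) + τ * (3 * (τ + ε) / d^2) :=
        add_le_add (mul_le_mul hFF hinv (abs_nonneg _) hτ) (mul_le_mul hMM h2 (abs_nonneg _) hτ)
    _ = _ := by ring

namespace IsEvenKernel

variable {k : E3 → ℝ}

lemma intervalIntegrable_clampHalf_margCdf (hk : IsEvenKernel k) (ρ : Measure E3)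
    [IsFiniteMeasure ρ] (j : Fin 3) (q a b : ℝ) :
    IntervalIntegrable (fun t => clampHalf q (margCdf k ρ j t)) volume a b :=
  ((monotone_clampHalf q).comp (hk.monotone_margCdf ρ j)).intervalIntegrable

lemma two_mul_medComp_sub (hk : IsEvenKernel k) (ρ ρ' : Measure E3) [IsFiniteMeasure ρ]
    [IsFiniteMeasure ρ'] {q A : ℝ} (hq : 0 < q) (j : Fin 3)
    (hM : 0 < ρ.real univ) (hM' : 0 < ρ'.real univ)
    (hb : (marg (mollify k ρ) j).real (Iic (-A)) ≤ (1/2 - q) * ρ.real univ ∧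
        (1/2 + q) * ρ.real univ < (marg (mollify k ρ) j).real (Iic A))
    (hb' : (marg (mollify k ρ') j).real (Iic (-A)) ≤ (1/2 - q) * ρ'.real univ ∧
        (1/2 + q) * ρ'.real univ < (marg (mollify k ρ') j).real (Iic A)) :
    2 * q * (medComp q (marg (mollify k ρ') j) - medComp q (marg (mollify k ρ) j))
      = ∫ t in (-A)..A, (clampHalf q (margCdf k ρ j t) - clampHalf q (margCdf k ρ' j t)) := by
  have key : ∀ (ν : Measure E3) [IsFiniteMeasure ν], 0 < ν.real univ →
      (marg (mollify k ν) j).real (Iic (-A)) ≤ (1/2 - q) * ν.real univ →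
      (1/2 + q) * ν.real univ < (marg (mollify k ν) j).real (Iic A) →
      2 * q * medComp q (marg (mollify k ν) j)
        = ∫ t in (-A)..A, (1/2 - clampHalf q (margCdf k ν j t)) := fun ν _ h1 h2 h3 => by
    have := hk.isFiniteMeasure_marg ν j
    have := nullSingletonClass_marg k ν j
    have hu := hk.marg_real_univ ν j
    have h := medComp_eq_integral (marg (mollify k ν) j) (q := q) (A := A) (by rwa [hu]) hq
      (by rwa [hu]) (by rwa [hu])
    rw [hu] at h
    exact h
  have hc : IntervalIntegrable (fun _ : ℝ => (1/2:ℝ)) volume (-A) A := intervalIntegrable_const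
  rw [mul_sub, key ρ' hM' hb'.1 hb'.2, key ρ hM hb.1 hb.2, ← intervalIntegral.integral_sub
    (hc.sub (hk.intervalIntegrable_clampHalf_margCdf ρ' j q _ _))
    (hc.sub (hk.intervalIntegrable_clampHalf_margCdf ρ j q _ _))]
  congr 1; ext t; ring

lemma abs_medComp_sub_le (hk : IsEvenKernel k) (ρ ρ' : Measure E3) [IsFiniteMeasure ρ]
    [IsFiniteMeasure ρ'] {q A : ℝ} (hq : 0 < q) (hA : 0 < A) (j : Fin 3)
    (hM : 0 < ρ.real univ) (hM' : 0 < ρ'.real univ)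
    (hb : (marg (mollify k ρ) j).real (Iic (-A)) ≤ (1/2 - q) * ρ.real univ ∧
        (1/2 + q) * ρ.real univ < (marg (mollify k ρ) j).real (Iic A))
    (hb' : (marg (mollify k ρ') j).real (Iic (-A)) ≤ (1/2 - q) * ρ'.real univ ∧
        (1/2 + q) * ρ'.real univ < (marg (mollify k ρ') j).real (Iic A))
    {θ : ℝ} (hθ : ∀ t, |margCdf k ρ' j t - margCdf k ρ j t| ≤ θ) :
    |medComp q (marg (mollify k ρ') j) - medComp q (marg (mollify k ρ) j)| ≤ A * θ / q := by
  have h1 := hk.two_mul_medComp_sub ρ ρ' hq j hM hM' hb hb'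
  have h2 := intervalIntegral.norm_integral_le_of_norm_le_const (a := -A) (b := A) (C := θ)
    (f := fun t => clampHalf q (margCdf k ρ j t) - clampHalf q (margCdf k ρ' j t)) fun t _ => by
      rw [Real.norm_eq_abs]
      refine (abs_clampHalf_sub_le q _ _).trans ?_
      rw [abs_sub_comm]
      exact hθ t
  rw [← h1, Real.norm_eq_abs, abs_mul, abs_of_pos (by positivity : 0 < 2 * q),
    abs_of_pos (by linarith : 0 < A - -A)] at h2
  rw [le_div_iff₀ hq]
  linarith

end IsEvenKernel

/-- First order expansion of the regularized median around an even reference measure. -/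
lemma exists_median_expansion {g : E3 → ℝ} (hk : IsEvenKernel g) {h ℓ : ℝ} (hh : 0 < h)
    (hℓ : 0 < ℓ) (hadapt : _root_.Adapted g h ℓ) {q β d A : ℝ} (hq : 0 < q) (hβ : 0 < β)
    (hd : 0 < d) (hA : 0 < A) (ρ₀ : Measure E3) [IsFiniteMeasure ρ₀] (hM₀ : d ≤ ρ₀.real univ)
    (hsymm : ρ₀.map (fun y => -y) = ρ₀) (j : Fin 3)
    (hb₀ : (marg (mollify (convFn g g) ρ₀) j).real (Iic (-A)) ≤ (1/2 - q) * ρ₀.real univ ∧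
        (1/2 + q) * ρ₀.real univ < (marg (mollify (convFn g g) ρ₀) j).real (Iic A))
    (hβp : β ≤ ρ₀.real {y : E3 | |y j - qtl (convFn g g) ρ₀ j (1/2 + q)| ≤ ℓ})
    (hβm : β ≤ ρ₀.real {y : E3 | |y j - qtl (convFn g g) ρ₀ j (1/2 - q)| ≤ ℓ}) :
    ∃ C > 0, ∀ (ρ ρ' : Measure E3) [IsFiniteMeasure ρ] [IsFiniteMeasure ρ'],
      d ≤ ρ.real univ → d ≤ ρ'.real univ →
      ((marg (mollify (convFn g g) ρ) j).real (Iic (-A)) ≤ (1/2 - q) * ρ.real univ ∧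
        (1/2 + q) * ρ.real univ < (marg (mollify (convFn g g) ρ) j).real (Iic A)) →
      ((marg (mollify (convFn g g) ρ') j).real (Iic (-A)) ≤ (1/2 - q) * ρ'.real univ ∧
        (1/2 + q) * ρ'.real univ < (marg (mollify (convFn g g) ρ') j).real (Iic A)) →
      |medComp q (marg (mollify (convFn g g) ρ) j)| ≤ C * tvMol g ρ ρ₀ ∧
      |medComp q (marg (mollify (convFn g g) ρ') j) - medComp q (marg (mollify (convFn g g) ρ) j)|
        ≤ C * tv ρ' ρ ∧
      |(∫ y, Hfun (convFn g g) q ρ₀ j y ∂ρ') - ∫ y, Hfun (convFn g g) q ρ₀ j y ∂ρ|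
        ≤ C * tv ρ' ρ ∧
      |medComp q (marg (mollify (convFn g g) ρ') j) - medComp q (marg (mollify (convFn g g) ρ) j)
          - ((∫ y, Hfun (convFn g g) q ρ₀ j y ∂ρ') - ∫ y, Hfun (convFn g g) q ρ₀ j y ∂ρ)|
        ≤ C * (tv ρ' ρ * (tv ρ' ρ + tvMol g ρ ρ₀)) := by
  set χ := convFn g g
  have hχ : IsEvenKernel χ := hk.convFn_self
  have hM₀0 := hd.trans_le hM₀
  have hfin₀ := hχ.isFiniteMeasure_marg ρ₀ j
  have hnull₀ := IsEvenKernel.nullSingletonClass_marg χ ρ₀ j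
  have hu₀ := hχ.marg_real_univ ρ₀ j
  obtain ⟨hAx, hxy, hyA, hFx, hFy⟩ := quantile_window (marg (mollify χ ρ₀) j) (q := q) (A := A)
    (by rwa [hu₀]) hq (by rw [hu₀]; exact hb₀.1) (by rw [hu₀]; exact hb₀.2)
  have hwin := integral_quantile_window (marg (mollify χ ρ₀) j) (q := q) (A := A)
    (by rwa [hu₀]) hq (by rw [hu₀]; exact hb₀.1) (by rw [hu₀]; exact hb₀.2)
  have hm₀ := hχ.medComp_eq_zero ρ₀ hM₀0 hsymm j hq hb₀.1 hb₀.2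
  have hHint : ∀ (ν : Measure E3) [IsFiniteMeasure ν], _ := fun ν _ =>
    hχ.integral_Hfun q ρ₀ j hxy ν
  rw [hu₀] at hFx hFy hwin
  change quantile (marg (mollify χ ρ₀) j) (1/2 - q)
    ≤ quantile (marg (mollify χ ρ₀) j) (1/2 + q) at hxy
  simp only [qtl] at hHint hβp hβm
  set x := quantile (marg (mollify χ ρ₀) j) (1/2 - q)
  set y := quantile (marg (mollify χ ρ₀) j) (1/2 + q)
  set F : Measure E3 → ℝ → ℝ := fun ν t => (marg (mollify χ ν) j).real (Iic t) with hF
  have hFmono : ∀ (ν : Measure E3) [IsFiniteMeasure ν], Monotone (F ν) := fun ν _ => by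
    have := hχ.isFiniteMeasure_marg ν j
    exact monotone_measureReal_Iic _
  set Q := y * (1/2 + q) - x * (1/2 - q) - 2 * q * medComp q (marg (mollify χ ρ₀) j)
  set c := β * (h^2 * ℓ)
  have hc : 0 < c := by positivity
  set κ := c * min 1 (ℓ / 4 / (2 * A)) / ρ₀.real univ
  have hκ : 0 < κ := by positivity
  have hgrow : ∀ z, z ∈ Icc (-A) A → β ≤ ρ₀.real {y : E3 | |y j - z| ≤ ℓ} →
      ∀ t ∈ Icc (-A) A, κ * |t - z| ≤ |margCdf χ ρ₀ j t - margCdf χ ρ₀ j z| := by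
    intro z hz hβz t ht
    have := mul_abs_sub_le_of_slope (hFmono ρ₀) hc (by positivity : 0 < ℓ/4) hA hz
      (fun t₁ t₂ h12 h1 h2 => hadapt.le_marg_real_sub hk hh hℓ ρ₀ j hβz h12 h1 h2) ht
    have e : margCdf χ ρ₀ j t - margCdf χ ρ₀ j z = (F ρ₀ t - F ρ₀ z) / ρ₀.real univ := by
      simp only [margCdf, hF]; ring
    rw [e, abs_div, abs_of_pos hM₀0, le_div_iff₀ hM₀0]
    calc κ * |t - z| * ρ₀.real univ = c * min 1 (ℓ / 4 / (2 * A)) * |t - z| := by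
          simp only [κ]; field_simp
      _ ≤ _ := this
  have hφx : margCdf χ ρ₀ j x = 1/2 - q := by rw [margCdf, hFx]; field_simp
  have hφy : margCdf χ ρ₀ j y = 1/2 + q := by rw [margCdf, hFy]; field_simp
  have hgx := hgrow x ⟨hAx, hxy.trans hyA⟩ hβm
  have hgy := hgrow y ⟨hAx.trans hxy, hyA⟩ hβp
  rw [hφx] at hgx
  rw [hφy] at hgy
  refine ⟨2 * A / (q * d) + (8 / (d^2 * κ) + 4 * A / d^2) / q, by positivity,
    fun ρ ρ' _ _ hM hM' hb hb' => ?_⟩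
  set τ := tv ρ' ρ
  set ε := tvMol g ρ ρ₀
  have hτ : 0 ≤ τ := (abs_nonneg _).trans (abs_mass_sub_le_tv ρ' ρ)
  have hε : 0 ≤ ε := IsEvenKernel.tvMol_nonneg g ρ ρ₀
  have hM0 := hd.trans_le hM
  have hM0' := hd.trans_le hM'
  have hφφ' := hχ.abs_margCdf_sub_le_tv ρ' ρ hd hM' hM j
  have hφφ₀ := hk.abs_margCdf_sub_le_tvMol ρ ρ₀ hd hM hM₀ j
  have hC1 : ∀ s, 0 ≤ s → 2 * A / (q * d) * s
      ≤ (2 * A / (q * d) + (8 / (d^2 * κ) + 4 * A / d^2) / q) * s := fun s hs =>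
    mul_le_mul_of_nonneg_right (le_add_of_nonneg_right (by positivity)) hs
  have hm := hχ.abs_medComp_sub_le ρ₀ ρ hq hA j hM₀0 hM0 hb₀ hb hφφ₀
  have hmm := hχ.abs_medComp_sub_le ρ ρ' hq hA j hM0 hM0' hb hb' hφφ'
  rw [hm₀, sub_zero] at hm
  set η := (∫ y, Hfun χ q ρ₀ j y ∂ρ') - ∫ y, Hfun χ q ρ₀ j y ∂ρ with hη
  have hFi : ∀ (ν : Measure E3) [IsFiniteMeasure ν], IntervalIntegrable (F ν) volume x y :=
    fun ν _ => (hFmono ν).intervalIntegrable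
  set G : ℝ → ℝ := fun t =>
    (F ρ₀ t / ρ₀.real univ * (ρ'.real univ - ρ.real univ) - (F ρ' t - F ρ t)) / ρ₀.real univ with hG
  have hGi : IntervalIntegrable G volume x y :=
    (((hFi ρ₀).div_const _).mul_const _ |>.sub ((hFi ρ').sub (hFi ρ))).div_const _
  have hηG : 2 * q * η = ∫ t in x..y, G t := by
    have e1 : (∫ t in x..y, G t) = ((∫ t in x..y, F ρ₀ t) / ρ₀.real univ
        * (ρ'.real univ - ρ.real univ) - ((∫ t in x..y, F ρ' t) - ∫ t in x..y, F ρ t))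
          / ρ₀.real univ := by
      simp only [hG]
      rw [intervalIntegral.integral_div, intervalIntegral.integral_sub
        (((hFi ρ₀).div_const _).mul_const _) ((hFi ρ').sub (hFi ρ)),
        intervalIntegral.integral_mul_const, intervalIntegral.integral_div,
        intervalIntegral.integral_sub (hFi ρ') (hFi ρ)]
    rw [e1, hη, hHint ρ', hHint ρ]
    change _ = ((∫ t in x..y, (marg (mollify χ ρ₀) j).real (Iic t)) / ρ₀.real univ
        * (ρ'.real univ - ρ.real univ) - ((∫ t in x..y, (marg (mollify χ ρ') j).real (Iic t))
          - ∫ t in x..y, (marg (mollify χ ρ) j).real (Iic t))) / ρ₀.real univ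
    rw [hwin]
    field_simp
    ring
  have hyx : |y - x| ≤ 2 * A := by rw [abs_of_nonneg (by linarith)]; linarith
  have hFFτ := hχ.abs_marg_real_Iic_sub_le_tv ρ' ρ j
  have hMMτ := abs_mass_sub_le_tv ρ' ρ
  have hηle : |2 * q * η| ≤ 2 * τ / d * (2 * A) := by
    rw [hηG, ← Real.norm_eq_abs]
    refine (intervalIntegral.norm_integral_le_of_norm_le_const (C := 2 * τ / d) fun t _ => ?_).trans
      (mul_le_mul_of_nonneg_left hyx (by positivity))
    rw [Real.norm_eq_abs, abs_div, abs_of_pos hM₀0]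
    refine div_le_div₀ (by positivity) ?_ hd hM₀
    have hφ : |F ρ₀ t / ρ₀.real univ| ≤ 1 := by
      rw [abs_of_nonneg (div_nonneg measureReal_nonneg hM₀0.le)]
      exact div_le_one_of_le₀ (hχ.marg_real_Iic_le ρ₀ j t) hM₀0.le
    refine (abs_sub _ _).trans ?_
    rw [abs_mul]
    have := mul_le_mul hφ hMMτ (abs_nonneg _) zero_le_one
    linarith [hFFτ t]
  have hexp : |2 * q * (medComp q (marg (mollify χ ρ') j) - medComp q (marg (mollify χ ρ) j) - η)|
      ≤ (16 / (d^2 * κ) + 8 * A / d^2) * (τ * (τ + ε)) := by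
    rw [mul_sub, hχ.two_mul_medComp_sub ρ ρ' hq j hM0 hM0' hb hb', hηG]
    have h1 := abs_integral_clampHalf_sub_le (q := q) (hχ.monotone_margCdf ρ₀ j)
      (hχ.monotone_margCdf ρ j) (hχ.monotone_margCdf ρ' j) hκ hAx hxy hyA hφx hφy hgx hgy
      (η := 2 * (τ + ε) / d) (θ := 2 * τ / d)
      (fun t => (hφφ₀ t).trans (div_le_div_of_nonneg_right (by linarith) hd.le))
      (fun t => by
        have := (abs_sub_le _ (margCdf χ ρ j t) _).trans (add_le_add (hφφ' t) (hφφ₀ t))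
        refine this.trans (le_of_eq ?_)
        ring)
      (fun t => by rw [abs_sub_comm]; exact hφφ' t)
    have hi : IntervalIntegrable (fun t => margCdf χ ρ j t - margCdf χ ρ' j t) volume x y :=
      (hχ.monotone_margCdf ρ j).intervalIntegrable.sub (hχ.monotone_margCdf ρ' j).intervalIntegrable
    have h2 : |(∫ t in x..y, (margCdf χ ρ j t - margCdf χ ρ' j t)) - ∫ t in x..y, G t|
        ≤ 4 * τ * (τ + ε) / d^2 * (2 * A) := by
      rw [← intervalIntegral.integral_sub hi hGi, ← Real.norm_eq_abs]
      refine (intervalIntegral.norm_integral_le_of_norm_le_const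
        (C := 4 * τ * (τ + ε) / d^2) fun t _ => ?_).trans
        (mul_le_mul_of_nonneg_left hyx (by positivity))
      exact abs_sub_expansion_le hd hM hM' hM₀ measureReal_nonneg (hχ.marg_real_Iic_le ρ₀ j t)
        (hFFτ t) hMMτ (hφφ₀ t) (hk.abs_mass_sub_le_tvMol ρ ρ₀)
    refine (abs_sub_le _ _ _).trans ((add_le_add h1 h2).trans (le_of_eq ?_))
    field_simp
    ring
  have h2q : (0:ℝ) < 2 * q := by positivity
  refine ⟨hm.trans (le_trans (le_of_eq ?_) (hC1 ε hε)),
    hmm.trans (le_trans (le_of_eq ?_) (hC1 τ hτ)), le_trans ?_ (hC1 τ hτ), ?_⟩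
  · field_simp
    rfl
  · field_simp
    rfl
  · rw [abs_mul, abs_of_pos h2q] at hηle
    have : |η| = 2 * q * |η| / (2 * q) := by field_simp
    rw [this, div_le_iff₀ h2q]
    refine hηle.trans (le_of_eq ?_)
    field_simp
  · rw [abs_mul, abs_of_pos h2q] at hexp
    set e := medComp q (marg (mollify χ ρ') j) - medComp q (marg (mollify χ ρ) j) - η
    have : |e| ≤ (8 / (d^2 * κ) + 4 * A / d^2) / q * (τ * (τ + ε)) := by
      have : |e| = 2 * q * |e| / (2 * q) := by field_simp
      rw [this, div_le_iff₀ h2q]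
      refine hexp.trans (le_of_eq ?_)
      field_simp
      ring
    exact this.trans (mul_le_mul_of_nonneg_right (le_add_of_nonneg_left (by positivity))
      (by positivity))

end MedianExpansion

section SmoothAverage

lemma sum_coord_mul_esingle (L : E3 →L[ℝ] ℝ) (v : E3) :
    L v = ∑ j : Fin 3, v j * L (esingle j) := by
  have hv : v = ∑ j : Fin 3, v j • esingle j := by
    ext i
    fin_cases i <;> simp [esingle, Fin.sum_univ_three]
  conv_lhs => rw [hv]
  simp

/-- First order Taylor estimate for two translates of a function with bounded second derivative. -/
lemma abs_sub_add_fderiv_le {u : E3 → ℝ} {N : ℝ} (hu : ContDiff ℝ 2 u)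
    (h2 : ∀ y, ‖fderiv ℝ (fderiv ℝ u) y‖ ≤ N) (y a b : E3) :
    |u (y - a) - u (y - b) + fderiv ℝ u y (a - b)| ≤ N * (‖a‖ + ‖b‖) * ‖a - b‖ := by
  have hN : 0 ≤ N := (ContinuousLinearMap.opNorm_nonneg _).trans (h2 0)
  have hd1 : Differentiable ℝ u := hu.differentiable (by norm_num)
  have hd2 : Differentiable ℝ (fderiv ℝ u) :=
    (hu.fderiv_right (m := 1) (by norm_num)).differentiable (by norm_num)
  have hlip : ∀ x, ‖fderiv ℝ u x - fderiv ℝ u y‖ ≤ N * ‖x - y‖ := fun x =>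
    convex_univ.norm_image_sub_le_of_norm_fderiv_le (𝕜 := ℝ) (fun z _ => hd2 z) (fun z _ => h2 z)
      (mem_univ _) (mem_univ _)
  have := (convex_closedBall y (‖a‖ + ‖b‖)).norm_image_sub_le_of_norm_hasFDerivWithin_le
    (f := fun x => u x - fderiv ℝ u y x) (f' := fun x => fderiv ℝ u x - fderiv ℝ u y)
    (C := N * (‖a‖ + ‖b‖)) (x := y - b) (y := y - a)
    (fun x _ => ((hd1 x).hasFDerivAt.sub (fderiv ℝ u y).hasFDerivAt).hasFDerivWithinAt)
    (fun x hx => (hlip x).trans (mul_le_mul_of_nonneg_left (by simpa [dist_eq_norm] using hx) hN))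
    (by simp) (by simp)
  rw [Real.norm_eq_abs, show y - a - (y - b) = -(a - b) by abel, norm_neg] at this
  refine le_trans (le_of_eq ?_) this
  simp only [map_sub]
  ring_nf

namespace IsEvenKernel

variable {k u : E3 → ℝ} {N : ℝ}

lemma convFn_translate (w : E3 → ℝ) (a y : E3) :
    convFn k (fun x => w (x - a)) y = convFn k w (y - a) := by
  unfold convFn
  simp only [sub_right_comm]

lemma fderiv_convFn (hk : IsEvenKernel k) (hu : ContDiff ℝ 1 u) (h0 : ∀ y, |u y| ≤ N)
    (h1 : ∀ y, ‖fderiv ℝ u y‖ ≤ N) (y e : E3) :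
    fderiv ℝ (convFn k u) y e = convFn k (fun x => fderiv ℝ u x e) y := by
  have hc1 : Continuous (fderiv ℝ u) := hu.continuous_fderiv (by norm_num)
  have hF' : ∀ x, AEStronglyMeasurable (fun z => k z • fderiv ℝ u (x - z)) volume := fun x =>
    (hk.continuous.smul (hc1.comp (continuous_const.sub continuous_id))).aestronglyMeasurable
  have hbd : ∀ x z, ‖k z • fderiv ℝ u (x - z)‖ ≤ k z * N := fun x z => by
    rw [norm_smul, Real.norm_eq_abs, abs_of_nonneg (hk.nonneg z)]
    exact mul_le_mul_of_nonneg_left (h1 _) (hk.nonneg z)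
  have := hasFDerivAt_integral_of_dominated_of_fderiv_le (𝕜 := ℝ) (μ := volume) (s := univ)
    (F := fun x z => k z * u (x - z)) (F' := fun x z => k z • fderiv ℝ u (x - z)) (x₀ := y)
    (bound := fun z => k z * N) univ_mem
    (Eventually.of_forall fun x => (hk.integrable_mul_comp_sub hu.continuous.measurable h0
      x).aestronglyMeasurable)
    (hk.integrable_mul_comp_sub hu.continuous.measurable h0 y) (hF' y)
    (ae_of_all _ fun z x _ => hbd x z) (hk.integrable.mul_const N)
    (ae_of_all _ fun z x _ => by
      have := ((hu.differentiable (by norm_num) (x - z)).hasFDerivAt.comp x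
        ((hasFDerivAt_id x).sub_const z)).const_mul (k z)
      simpa using this)
  have hi : Integrable fun z => k z • fderiv ℝ u (y - z) :=
    (hk.integrable.mul_const N).mono' (hF' y) (ae_of_all _ (hbd y))
  change HasFDerivAt (convFn k u) _ y at this
  rw [this.fderiv, ContinuousLinearMap.integral_apply hi]
  rfl

lemma abs_convFn_translate_sub_le (hk : IsEvenKernel k) (hu : ContDiff ℝ 1 u)
    (h0 : ∀ y, |u y| ≤ N) (h1 : ∀ y, ‖fderiv ℝ u y‖ ≤ N) (y a b : E3) :
    |convFn k u (y - a) - convFn k u (y - b)| ≤ N * ‖a - b‖ := by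
  have hum := hu.continuous.measurable
  have hua : Measurable fun x : E3 => u (x - a) := hum.comp (measurable_id.sub_const a)
  have hub : Measurable fun x : E3 => u (x - b) := hum.comp (measurable_id.sub_const b)
  have e : convFn k u (y - a) - convFn k u (y - b)
      = convFn k (fun x => u (x - a) - u (x - b)) y := by
    rw [← convFn_translate, ← convFn_translate]
    unfold convFn
    rw [← integral_sub (hk.integrable_mul_comp_sub hua (fun _ => h0 _) y)
      (hk.integrable_mul_comp_sub hub (fun _ => h0 _) y)]
    simp only [mul_sub]
  rw [e]
  refine hk.abs_convFn_le (fun x => ?_) y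
  have := convex_univ.norm_image_sub_le_of_norm_fderiv_le (𝕜 := ℝ)
    (fun z _ => hu.differentiable (by norm_num) z) (fun z _ => h1 z) (mem_univ (x - b))
    (mem_univ (x - a))
  rwa [Real.norm_eq_abs, show x - a - (x - b) = -(a - b) by abel, norm_neg] at this

lemma abs_convFn_translate_sub_add_le (hk : IsEvenKernel k) (hu : ContDiff ℝ 2 u)
    (h0 : ∀ y, |u y| ≤ N) (h1 : ∀ y, ‖fderiv ℝ u y‖ ≤ N)
    (h2 : ∀ y, ‖fderiv ℝ (fderiv ℝ u) y‖ ≤ N) (y a b : E3) :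
    |convFn k u (y - a) - convFn k u (y - b) + fderiv ℝ (convFn k u) y (a - b)|
      ≤ N * (‖a‖ + ‖b‖) * ‖a - b‖ := by
  have hu1 : ContDiff ℝ 1 u := hu.of_le (by norm_num)
  have hum := hu.continuous.measurable
  have hua : Measurable fun x : E3 => u (x - a) := hum.comp (measurable_id.sub_const a)
  have hub : Measurable fun x : E3 => u (x - b) := hum.comp (measurable_id.sub_const b)
  have hud : Measurable fun x : E3 => fderiv ℝ u x (a - b) :=
    ((hu1.continuous_fderiv (by norm_num)).clm_apply continuous_const).measurable
  have e : convFn k u (y - a) - convFn k u (y - b) + fderiv ℝ (convFn k u) y (a - b)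
      = convFn k (fun x => u (x - a) - u (x - b) + fderiv ℝ u x (a - b)) y := by
    rw [hk.fderiv_convFn hu1 h0 h1, ← convFn_translate, ← convFn_translate]
    unfold convFn
    have ia := hk.integrable_mul_comp_sub hua (fun _ => h0 _) y
    have ib := hk.integrable_mul_comp_sub hub (fun _ => h0 _) y
    have id := hk.integrable_mul_comp_sub hud (B := N * ‖a - b‖) (fun x =>
      (ContinuousLinearMap.le_opNorm _ _).trans
        (mul_le_mul_of_nonneg_right (h1 x) (norm_nonneg _))) y
    have iab : Integrable fun z => k z * u (y - z - a) - k z * u (y - z - b) := ia.sub ib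
    rw [← integral_sub ia ib, ← integral_add iab id]
    simp only [mul_sub, mul_add]
  rw [e]
  exact hk.abs_convFn_le (fun x => abs_sub_add_fderiv_le hu h2 x a b) y

end IsEvenKernel

end SmoothAverage

section VectorAverage

namespace IsEvenKernel

variable {k : E3 → ℝ} {F : E3 → E3} {M : ℝ}

lemma inner_convVec (hk : IsEvenKernel k) (hF : Continuous F) (hM : ∀ y, ‖F y‖ ≤ M) (p y : E3) :
    ⟪p, convVec k F y⟫ = convFn k (fun x => ⟪p, F x⟫) y := by
  have hi : Integrable fun z => k z • F (y - z) :=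
    (hk.integrable.mul_const M).mono'
      (hk.continuous.smul (hF.comp (continuous_const.sub continuous_id))).aestronglyMeasurable
      (ae_of_all _ fun z => by
        rw [norm_smul, Real.norm_eq_abs, abs_of_nonneg (hk.nonneg z)]
        exact mul_le_mul_of_nonneg_left (hM _) (hk.nonneg z))
  unfold convVec convFn
  rw [← integral_inner hi]
  simp only [inner_smul_right]

lemma norm_convVec_le (hk : IsEvenKernel k) (hM : ∀ y, ‖F y‖ ≤ M) (y : E3) :
    ‖convVec k F y‖ ≤ M := by
  have := norm_integral_le_of_norm_le (hk.integrable.mul_const M)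
    (ae_of_all _ fun z => (by
        rw [norm_smul, Real.norm_eq_abs, abs_of_nonneg (hk.nonneg z)]
        exact mul_le_mul_of_nonneg_left (hM _) (hk.nonneg z) : ‖k z • F (y - z)‖ ≤ k z * M))
  rwa [integral_mul_const, hk.integral_one, one_mul] at this

lemma stronglyMeasurable_convVec (hk : IsEvenKernel k) (hF : Continuous F) :
    StronglyMeasurable (convVec k F) := by
  have : StronglyMeasurable (Function.uncurry fun y z : E3 => k z • F (y - z)) :=
    ((hk.continuous.comp continuous_snd).smul
      (hF.comp (continuous_fst.sub continuous_snd))).stronglyMeasurable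
  exact this.integral_prod_right

lemma inner_Bfun (hk : IsEvenKernel k) (hF : Continuous F) (hM : ∀ y, ‖F y‖ ≤ M) (χ : E3 → ℝ)
    (q : ℝ) (p : E3) (ρ : Measure E3) [IsFiniteMeasure ρ] :
    ⟪p, Bfun χ q (convVec k F) ρ⟫ = ⟪p, med q (mollify χ ρ)⟫
      + ∫ y, convFn k (fun x => ⟪p, F x⟫) (y - med q (mollify χ ρ)) ∂ρ := by
  have hi : Integrable (fun y => convVec k F (y - med q (mollify χ ρ))) ρ :=
    Integrable.of_bound ((hk.stronglyMeasurable_convVec hF).comp_measurable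
      (measurable_id.sub_const _)).aestronglyMeasurable M (ae_of_all _ fun y => hk.norm_convVec_le hM _)
  unfold Bfun
  rw [inner_add_right, ← integral_inner hi]
  simp only [hk.inner_convVec hF hM]

end IsEvenKernel

/-- The scalar components of a `CB2` field are twice differentiable with derivatives bounded
linearly in the direction. -/
lemma CB2.exists_inner_bound {F : E3 → E3} (hF : CB2 F) : ∃ M > 0, (∀ y, ‖F y‖ ≤ M) ∧
    ∀ p : E3, ContDiff ℝ 2 (fun y => ⟪p, F y⟫) ∧ (∀ y, |⟪p, F y⟫| ≤ M * ‖p‖) ∧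
      (∀ y, ‖fderiv ℝ (fun y => ⟪p, F y⟫) y‖ ≤ M * ‖p‖) ∧
      ∀ y, ‖fderiv ℝ (fderiv ℝ fun y => ⟪p, F y⟫) y‖ ≤ M * ‖p‖ := by
  obtain ⟨hc, M, hM⟩ := hF
  refine ⟨M + 1, ?_, fun y => (hM y).1.trans (by linarith), fun p => ?_⟩
  · linarith [(norm_nonneg _).trans (hM 0).1]
  have hle : ∀ t, t ≤ M → ‖p‖ * t ≤ (M + 1) * ‖p‖ := fun t ht => by
    nlinarith [norm_nonneg p]
  have hd1 : Differentiable ℝ F := hc.differentiable (by norm_num)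
  have hd2 : Differentiable ℝ (fderiv ℝ F) :=
    (hc.fderiv_right (m := 1) (by norm_num)).differentiable (by norm_num)
  have hp : ‖innerSL ℝ p‖ = ‖p‖ := innerSL_apply_norm ℝ p
  have e1 : fderiv ℝ (fun y => ⟪p, F y⟫)
      = fun y => ContinuousLinearMap.compL ℝ E3 E3 ℝ (innerSL ℝ p) (fderiv ℝ F y) := by
    funext y
    exact ((innerSL ℝ p).hasFDerivAt.comp y (hd1 y).hasFDerivAt).fderiv
  have hcomp : ‖ContinuousLinearMap.compL ℝ E3 E3 ℝ (innerSL ℝ p)‖ ≤ ‖p‖ := by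
    refine ContinuousLinearMap.opNorm_le_bound _ (norm_nonneg _) fun L => ?_
    rw [← hp]
    exact ContinuousLinearMap.opNorm_comp_le _ _
  refine ⟨contDiff_const.inner ℝ hc, fun y => ?_, fun y => ?_, fun y => ?_⟩
  · exact (abs_real_inner_le_norm _ _).trans (hle _ (hM y).1)
  · rw [e1]
    refine (ContinuousLinearMap.opNorm_comp_le _ _).trans ?_
    rw [hp]
    exact hle _ (hM y).2.1
  · rw [e1]
    have := ((ContinuousLinearMap.compL ℝ E3 E3 ℝ (innerSL ℝ p)).hasFDerivAt.comp y
      (hd2 y).hasFDerivAt).fderiv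
    simp only [Function.comp_def] at this
    rw [this]
    refine (ContinuousLinearMap.opNorm_comp_le _ _).trans
      ((mul_le_mul_of_nonneg_right hcomp (norm_nonneg _)).trans (hle _ (hM y).2.2))

end VectorAverage

section Assembly

lemma norm_le_three_mul {v : E3} {B : ℝ} (h : ∀ j, |v j| ≤ B) : ‖v‖ ≤ 3 * B := by
  have hB : 0 ≤ B := (abs_nonneg _).trans (h 0)
  rw [EuclideanSpace.norm_eq, Real.sqrt_le_left (by positivity)]
  calc ∑ j, ‖v j‖^2 ≤ ∑ _j : Fin 3, B^2 :=
        Finset.sum_le_sum fun j _ => pow_le_pow_left₀ (norm_nonneg _) (h j) 2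
    _ ≤ (3 * B)^2 := by simp; nlinarith [sq_nonneg B]

lemma abs_sum_three_mul_le {a b : Fin 3 → ℝ} {A B : ℝ} (ha : ∀ j, |a j| ≤ A) (hb : ∀ j, |b j| ≤ B) :
    |∑ j, a j * b j| ≤ 3 * (A * B) := by
  have hA : 0 ≤ A := (abs_nonneg _).trans (ha 0)
  refine (Finset.abs_sum_le_sum_abs _ _).trans ?_
  calc ∑ j, |a j * b j| ≤ ∑ _j : Fin 3, A * B := Finset.sum_le_sum fun j _ => by
        rw [abs_mul]
        exact mul_le_mul (ha j) (hb j) (abs_nonneg _) hA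
    _ = 3 * (A * B) := by simp

lemma abs_integral_le_mul_mass {w : E3 → ℝ} {B D : ℝ} (ρ : Measure E3) [IsFiniteMeasure ρ]
    (hB : ∀ y, |w y| ≤ B) (hD : ρ.real univ ≤ D) : |∫ y, w y ∂ρ| ≤ B * D := by
  have hB0 : 0 ≤ B := (abs_nonneg _).trans (hB 0)
  exact (norm_integral_le_of_norm_le_const (f := w) (ae_of_all _ hB)).trans
    (mul_le_mul_of_nonneg_left hD hB0)

lemma abs_sq_sub_sq_le {a b P τ s K : ℝ} (hab : |a - b| ≤ P * K * (τ * s)) (ha : |a| ≤ P * K * τ)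
    (hb : |b| ≤ P * K * τ) : |a^2 - b^2| ≤ 2 * K^2 * τ^2 * s * P^2 := by
  rw [sq_sub_sq, mul_comm, abs_mul]
  calc |a - b| * |a + b| ≤ P * K * (τ * s) * (P * K * τ + P * K * τ) :=
        mul_le_mul hab ((abs_add_le a b).trans (add_le_add ha hb)) (abs_nonneg _)
          ((abs_nonneg _).trans hab)
    _ = _ := by ring

/-- Linearization of the translated averages `∫ U(y - m) dρ` of `U = k * u`. -/
lemma IsEvenKernel.abs_translate_sub_linear_le {k u : E3 → ℝ} {N C D ε : ℝ} (hk : IsEvenKernel k)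
    (hu : ContDiff ℝ 2 u) (h0 : ∀ y, |u y| ≤ N) (h1 : ∀ y, ‖fderiv ℝ u y‖ ≤ N)
    (h2 : ∀ y, ‖fderiv ℝ (fderiv ℝ u) y‖ ≤ N) (hC : 0 ≤ C) (ρ₀ ρ ρ' : Measure E3)
    [IsFiniteMeasure ρ₀] [IsFiniteMeasure ρ] [IsFiniteMeasure ρ'] (hD₀ : ρ₀.real univ ≤ D)
    (hD : ρ.real univ ≤ D) {m m' : E3} {η : Fin 3 → ℝ} (hε : 0 ≤ ε) (hm : ∀ j, |m j| ≤ C * ε)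
    (hmm : ∀ j, |m' j - m j| ≤ C * tv ρ' ρ) (hη : ∀ j, |η j| ≤ C * tv ρ' ρ)
    (he : ∀ j, |m' j - m j - η j| ≤ C * (tv ρ' ρ * (tv ρ' ρ + ε))) :
    |((∫ y, convFn k u (y - m') ∂ρ') - ∫ y, convFn k u (y - m) ∂ρ)
        - ((∫ y, convFn k u y ∂ρ') - (∫ y, convFn k u y ∂ρ)
          - ∑ j, (∫ y, fderiv ℝ (convFn k u) y (esingle j) ∂ρ₀) * η j)|
      ≤ N * (1 + 6 * C + 3 * C * D + 18 * C^2 * D)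
        * (tv ρ' ρ * (tv ρ' ρ + ε + tvMol k ρ ρ₀)) ∧
    |(∫ y, convFn k u (y - m') ∂ρ') - ∫ y, convFn k u (y - m) ∂ρ|
      ≤ N * (1 + 6 * C + 3 * C * D + 18 * C^2 * D) * tv ρ' ρ ∧
    |(∫ y, convFn k u y ∂ρ') - (∫ y, convFn k u y ∂ρ)
          - ∑ j, (∫ y, fderiv ℝ (convFn k u) y (esingle j) ∂ρ₀) * η j|
      ≤ N * (1 + 6 * C + 3 * C * D + 18 * C^2 * D) * tv ρ' ρ := by
  have hu1 : ContDiff ℝ 1 u := hu.of_le (by norm_num)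
  have hN : 0 ≤ N := (abs_nonneg _).trans (h0 0)
  have hD0 : 0 ≤ D := measureReal_nonneg.trans hD
  set τ := tv ρ' ρ
  have hτ : 0 ≤ τ := (abs_nonneg _).trans (abs_mass_sub_le_tv ρ' ρ)
  set εk := tvMol k ρ ρ₀
  have hεk : 0 ≤ εk := IsEvenKernel.tvMol_nonneg k ρ ρ₀
  set U := convFn k u with hU
  have hUm : Measurable U := hk.measurable_convFn hu.continuous.measurable
  have hUt : ∀ a : E3, Measurable fun y => U (y - a) := fun a => hUm.comp (measurable_id.sub_const a)
  have hUb : ∀ y, |U y| ≤ N := hk.abs_convFn_le h0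
  have hUi : ∀ (ν : Measure E3) [IsFiniteMeasure ν] (a : E3), Integrable (fun y => U (y - a)) ν :=
    fun ν _ a => Integrable.of_bound (hUt a).aestronglyMeasurable N (ae_of_all _ fun y => hUb _)
  have hUi0 : ∀ (ν : Measure E3) [IsFiniteMeasure ν], Integrable U ν :=
    fun ν _ => Integrable.of_bound hUm.aestronglyMeasurable N (ae_of_all _ hUb)
  have hdu : ∀ v : E3, Measurable fun x => fderiv ℝ u x v := fun v =>
    ((hu1.continuous_fderiv (by norm_num)).clm_apply continuous_const).measurable
  have hdub : ∀ v x : E3, |fderiv ℝ u x v| ≤ N * ‖v‖ := fun v x =>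
    (ContinuousLinearMap.le_opNorm _ _).trans (mul_le_mul_of_nonneg_right (h1 x) (norm_nonneg _))
  have hdU : ∀ v : E3, (fun y => fderiv ℝ U y v) = convFn k fun x => fderiv ℝ u x v :=
    fun v => funext fun y => hk.fderiv_convFn hu1 h0 h1 y v
  have hdUb : ∀ v y : E3, |fderiv ℝ U y v| ≤ N * ‖v‖ := fun v y => by
    rw [congrFun (hdU v) y]
    exact hk.abs_convFn_le (hdub v) y
  have hdUi : ∀ (ν : Measure E3) [IsFiniteMeasure ν] (v : E3),
      Integrable (fun y => fderiv ℝ U y v) ν := fun ν _ v => by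
    rw [hdU v]
    exact hk.integrable_convFn ν (hdu v) (hdub v)
  set J : Fin 3 → ℝ := fun j => ∫ y, fderiv ℝ U y (esingle j) ∂ρ₀ with hJ
  have hJb : ∀ j, |J j| ≤ N * D := fun j => abs_integral_le_mul_mass ρ₀
    (fun y => (hdUb _ y).trans (by simp [esingle])) hD₀
  have hJv : ∀ v : E3, ∫ y, fderiv ℝ U y v ∂ρ₀ = ∑ j, v j * J j := fun v => by
    have : (fun y => fderiv ℝ U y v) = fun y => ∑ j, v j * fderiv ℝ U y (esingle j) :=
      funext fun y => sum_coord_mul_esingle _ v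
    rw [this, integral_finsetSum _ fun j _ => (hdUi ρ₀ _).const_mul _]
    simp only [integral_const_mul, hJ]
  have hnm : ‖m‖ ≤ 3 * (C * ε) := norm_le_three_mul hm
  have hnmm : ‖m' - m‖ ≤ 3 * (C * τ) := norm_le_three_mul hmm
  have hnm' : ‖m'‖ ≤ 3 * (C * (τ + ε)) := by
    have := norm_add_le (m' - m) m
    rw [sub_add_cancel] at this
    linarith
  have hT1 : |(∫ y, (U (y - m') - U y) ∂ρ') - ∫ y, (U (y - m') - U y) ∂ρ|
      ≤ N * (3 * (C * (τ + ε))) * τ := by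
    refine abs_integral_sub_integral_le_tv ρ' ρ ((hUt m').sub hUm) fun y => ?_
    have := hk.abs_convFn_translate_sub_le hu1 h0 h1 y m' 0
    rw [sub_zero, sub_zero] at this
    exact this.trans (mul_le_mul_of_nonneg_left hnm' hN)
  have hT2 : |∫ y, (U (y - m') - U (y - m) + fderiv ℝ U y (m' - m)) ∂ρ|
      ≤ N * (3 * (C * (τ + ε)) + 3 * (C * ε)) * (3 * (C * τ)) * D :=
    abs_integral_le_mul_mass ρ (fun y =>
      (hk.abs_convFn_translate_sub_add_le hu h0 h1 h2 y m' m).trans (by gcongr)) hD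
  have hT3 : |(∫ y, fderiv ℝ U y (m' - m) ∂ρ) - ∫ y, fderiv ℝ U y (m' - m) ∂ρ₀|
      ≤ N * (3 * (C * τ)) * εk := by
    rw [hdU]
    refine (hk.abs_integral_convFn_sub_le ρ ρ₀ (hdu _) (hdub _)).trans ?_
    gcongr
  have hT4 : |∑ j, (m' j - m j - η j) * J j| ≤ 3 * (C * (τ * (τ + ε)) * (N * D)) :=
    abs_sum_three_mul_le he hJb
  have hS : |∑ j, J j * η j| ≤ 3 * (N * D * (C * τ)) := abs_sum_three_mul_le hJb hη
  have hU1 : |(∫ y, U y ∂ρ') - ∫ y, U y ∂ρ| ≤ N * τ :=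
    abs_integral_sub_integral_le_tv ρ' ρ hUm hUb
  have hU2 : |(∫ y, U (y - m') ∂ρ') - ∫ y, U (y - m') ∂ρ| ≤ N * τ :=
    abs_integral_sub_integral_le_tv ρ' ρ (hUt m') fun y => hUb _
  have hU3 : |∫ y, (U (y - m') - U (y - m)) ∂ρ| ≤ N * (3 * (C * τ)) * D :=
    abs_integral_le_mul_mass ρ (fun y =>
      (hk.abs_convFn_translate_sub_le hu1 h0 h1 y m' m).trans
        (mul_le_mul_of_nonneg_left hnmm hN)) hD
  refine ⟨?_, ?_, ?_⟩
  · have key : ((∫ y, U (y - m') ∂ρ') - ∫ y, U (y - m) ∂ρ)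
        - ((∫ y, U y ∂ρ') - (∫ y, U y ∂ρ) - ∑ j, J j * η j)
        = ((∫ y, (U (y - m') - U y) ∂ρ') - ∫ y, (U (y - m') - U y) ∂ρ)
          + (∫ y, (U (y - m') - U (y - m) + fderiv ℝ U y (m' - m)) ∂ρ)
          - ((∫ y, fderiv ℝ U y (m' - m) ∂ρ) - ∫ y, fderiv ℝ U y (m' - m) ∂ρ₀)
          - ∑ j, (m' j - m j - η j) * J j := by
      have hd : Integrable (fun y => U (y - m') - U (y - m)) ρ := (hUi ρ m').sub (hUi ρ m)
      rw [integral_sub (hUi ρ' m') (hUi0 ρ'), integral_sub (hUi ρ m') (hUi0 ρ),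
        integral_add hd (hdUi ρ _), integral_sub (hUi ρ m') (hUi ρ m), hJv]
      simp only [Fin.sum_univ_three, PiLp.sub_apply]
      ring
    rw [key]
    refine (abs_sub _ _).trans ((add_le_add ((abs_sub _ _).trans (add_le_add
      ((abs_add_le _ _).trans (add_le_add hT1 hT2)) hT3)) hT4).trans ?_)
    have : 0 ≤ N * τ * ((τ + ε + εk) + 3 * C * (τ + ε + εk) + 9 * C^2 * D * τ
        + 18 * C^2 * D * εk + 3 * C * D * εk) := by positivity
    linarith
  · have key : (∫ y, U (y - m') ∂ρ') - ∫ y, U (y - m) ∂ρ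
        = ((∫ y, U (y - m') ∂ρ') - ∫ y, U (y - m') ∂ρ) + ∫ y, (U (y - m') - U (y - m)) ∂ρ := by
      rw [integral_sub (hUi ρ m') (hUi ρ m)]
      ring
    rw [key]
    refine (abs_add_le _ _).trans ((add_le_add hU2 hU3).trans ?_)
    have : 0 ≤ N * (6 * C) * τ + N * (18 * C^2 * D) * τ := by positivity
    nlinarith
  · refine (abs_sub _ _).trans ((add_le_add hU1 hS).trans ?_)
    have : 0 ≤ N * (6 * C) * τ + N * (18 * C^2 * D) * τ := by positivity
    nlinarith

end Assembly

@[simp]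
lemma vec3_apply (f : Fin 3 → ℝ) (j : Fin 3) : vec3 f j = f j := rfl

lemma inner_vec3 (p : E3) (f : Fin 3 → ℝ) : ⟪p, vec3 f⟫ = ∑ j, p j * f j := by
  simp [PiLp.inner_apply, mul_comm]

/-- quadratic expansion of the boost increment `[p·𝓑(ρ') - p·𝓑(ρ)]²`. -/
theorem stmt9 (g : E3 → ℝ) (hg : IsMollifier g) (hrot : RotInv g)
    (h ℓ : ℝ) (hh : 0 < h) (hℓ : 0 < ℓ) (hadapt : Adapted g h ℓ)
    (q β d D δ R R' : ℝ)
    (hq0 : 0 < q) (hq : q < 1/2) (hβ : 0 < β) (hd : 0 < d) (hD : 0 < D) (hδ0 : 0 < δ)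
    (hR : 0 < R) (hR' : 0 < R') (hδ : δ < d^2/2) (hqδ : q ≤ 1/2 - δ/d^2)
    (ρ₀ : Measure E3) [IsFiniteMeasure ρ₀] (hρ₀ : ρ₀ ≠ 0)
    (hρ₀rot : ∀ O : E3 ≃ₗᵢ[ℝ] E3, ρ₀.map O = ρ₀)
    (f₀ : E3 → E3) (hf₀ : CB2 f₀) :
    ∃ C > (0:ℝ), ∀ T : ℝ, 0 < T → ∀ p : E3,
      ∀ (ρ ρ' : Measure E3) [IsFiniteMeasure ρ] [IsFiniteMeasure ρ'],
        Admissible (convFn g g) q ℓ β d D δ R R' ρ₀ ρ ρ' →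
        |(⟪p, Bfun (convFn g g) q (convVec (fun y => T^3 * g (T • y)) f₀) ρ'⟫
            - ⟪p, Bfun (convFn g g) q (convVec (fun y => T^3 * g (T • y)) f₀) ρ⟫)^2
          - ((∫ y, ⟪p, vec3 (fun j => Hfun (convFn g g) q ρ₀ j y)
                  + convVec (fun z => T^3 * g (T • z)) f₀ y⟫ ∂ρ'
              - ∫ y, ⟪p, vec3 (fun j => Hfun (convFn g g) q ρ₀ j y)
                  + convVec (fun z => T^3 * g (T • z)) f₀ y⟫ ∂ρ)
            - ∑ j : Fin 3,
                (∫ y, fderiv ℝ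
                    (fun w => ⟪p, convVec (fun z => T^3 * g (T • z)) f₀ w⟫) y (esingle j) ∂ρ₀)
                  * ((∫ y, Hfun (convFn g g) q ρ₀ j y ∂ρ')
                      - ∫ y, Hfun (convFn g g) q ρ₀ j y ∂ρ))^2|
        ≤ C * (tv ρ' ρ)^2
            * (tv ρ' ρ + tvMol g ρ ρ₀ + tvMol (fun y => T^3 * g (T • y)) ρ ρ₀) * ‖p‖^2 := by
  have hk : IsEvenKernel g := hg.isEvenKernel hrot
  have hχ : IsEvenKernel (convFn g g) := hk.convFn_self
  by_cases h₀ : MassCond d D δ R ρ₀ ∧ ∀ j : Fin 3,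
      β ≤ (ρ₀ {y : E3 | |y j - qtl (convFn g g) ρ₀ j (1/2 + q)| ≤ ℓ}).toReal ∧
      β ≤ (ρ₀ {y : E3 | |y j - qtl (convFn g g) ρ₀ j (1/2 - q)| ≤ ℓ}).toReal
  swap
  · exact ⟨1, one_pos, fun T _ p ρ ρ' _ _ hadm => absurd ⟨hadm.2.1, hadm.2.2.2.2⟩ h₀⟩
  obtain ⟨hmass₀, hβ₀⟩ := h₀
  obtain ⟨M, hM0, hMF, hMp⟩ := hf₀.exists_inner_bound
  obtain ⟨A, hA, hbr⟩ := hχ.exists_marg_bracket (q := q) hd hδ0 hR hR' hδ hqδ ρ₀ hmass₀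
  have hsymm : ρ₀.map (fun y => -y) = ρ₀ := hρ₀rot (LinearIsometryEquiv.neg ℝ)
  have hbr₀ := hbr ρ₀ hmass₀ q hq0 le_rfl (by simpa using hR'.le)
  choose c hc hexp using fun j => exists_median_expansion hk hh hℓ hadapt hq0 hβ hd hA ρ₀
    hmass₀.1 hsymm j (hbr₀ j) (hβ₀ j).1 (hβ₀ j).2
  set C := ∑ j, c j
  have hcC : ∀ j, c j ≤ C := fun j => Finset.single_le_sum (fun i _ => (hc i).le) (Finset.mem_univ j)
  have hC : 0 < C := (hc 0).trans_le (hcC 0)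
  set K := 3 * C + M * (1 + 6 * C + 3 * C * D + 18 * C^2 * D)
  have hK : 0 < K := by positivity
  refine ⟨2 * K^2, by positivity, fun T hT p ρ ρ' _ _ hadm => ?_⟩
  obtain ⟨⟨qt, hqt0, hqtq, hmed⟩, -, hmass, hmass', -⟩ := hadm
  set k : E3 → ℝ := fun y => T^3 * g (T • y)
  have hkT : IsEvenKernel k := hk.scale hT
  set χ := convFn g g
  set τ := tv ρ' ρ
  set ε := tvMol g ρ ρ₀
  have hτ : 0 ≤ τ := (abs_nonneg _).trans (abs_mass_sub_le_tv ρ' ρ)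
  have hε : 0 ≤ ε := IsEvenKernel.tvMol_nonneg g ρ ρ₀
  have hεT : 0 ≤ tvMol k ρ ρ₀ := IsEvenKernel.tvMol_nonneg k ρ ρ₀
  have hb := hbr ρ hmass qt hqt0 hqtq (by linarith [norm_nonneg (med qt ρ' - med qt ρ)])
  have hb' := hbr ρ' hmass' qt hqt0 hqtq (by
    have := norm_add_le (med qt ρ' - med qt ρ) (med qt ρ - med qt ρ₀)
    rw [sub_add_sub_cancel] at this
    linarith)
  set η : Fin 3 → ℝ := fun j => (∫ y, Hfun χ q ρ₀ j y ∂ρ') - ∫ y, Hfun χ q ρ₀ j y ∂ρ with hη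
  set m := med q (mollify χ ρ) with hm
  set m' := med q (mollify χ ρ') with hm'
  have hbounds : ∀ j, |m j| ≤ C * ε ∧ |m' j - m j| ≤ C * τ ∧ |η j| ≤ C * τ ∧
      |m' j - m j - η j| ≤ C * (τ * (τ + ε)) := fun j => by
    obtain ⟨e1, e2, e3, e4⟩ := hexp j ρ ρ' hmass.1 hmass'.1 (hb j) (hb' j)
    exact ⟨e1.trans (mul_le_mul_of_nonneg_right (hcC j) hε),
      e2.trans (mul_le_mul_of_nonneg_right (hcC j) hτ),
      e3.trans (mul_le_mul_of_nonneg_right (hcC j) hτ),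
      e4.trans (mul_le_mul_of_nonneg_right (hcC j) (by positivity))⟩
  have hcont : Continuous f₀ := hf₀.1.continuous
  obtain ⟨hu, hu0, hu1, hu2⟩ := hMp p
  obtain ⟨hAL, hA', hL⟩ := hkT.abs_translate_sub_linear_le hu hu0 hu1 hu2 hC.le ρ₀ ρ ρ' hmass₀.2.1
    hmass.2.1 hε (fun j => (hbounds j).1) (fun j => (hbounds j).2.1) (fun j => (hbounds j).2.2.1)
    fun j => (hbounds j).2.2.2
  rw [hkT.inner_Bfun hcont hMF, hkT.inner_Bfun hcont hMF]
  simp only [inner_add_right, inner_vec3, hkT.inner_convVec hcont hMF]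
  rw [← hm, ← hm']
  set U := convFn k fun x => ⟪p, f₀ x⟫ with hU
  have hUi : ∀ (ν : Measure E3) [IsFiniteMeasure ν], Integrable U ν := fun ν _ =>
    hkT.integrable_convFn ν hu.continuous.measurable hu0
  have hHi : ∀ (ν : Measure E3) [IsFiniteMeasure ν] (j : Fin 3), Integrable (Hfun χ q ρ₀ j) ν :=
    fun ν _ j => by
      obtain ⟨B, hB⟩ := hχ.exists_abs_Hfun_le q ρ₀ j
      exact Integrable.of_bound (hχ.measurable_Hfun q ρ₀ j).aestronglyMeasurable B (ae_of_all _ hB)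
  have hsplit : ∀ (ν : Measure E3) [IsFiniteMeasure ν],
      ∫ y, ((∑ j, p j * Hfun χ q ρ₀ j y) + U y) ∂ν
        = (∑ j, p j * ∫ y, Hfun χ q ρ₀ j y ∂ν) + ∫ y, U y ∂ν := fun ν _ => by
    rw [integral_add (integrable_finsetSum _ fun j _ => (hHi ν j).const_mul _) (hUi ν),
      integral_finsetSum _ fun j _ => (hHi ν j).const_mul _]
    simp only [integral_const_mul]
  have hip : ∀ v : E3, ⟪p, v⟫ = ∑ j, p j * v j := fun v => by simp [PiLp.inner_apply, mul_comm]
  have hpj : ∀ j, |p j| ≤ ‖p‖ := abs_coord_le_norm p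
  rw [hsplit ρ', hsplit ρ, hip, hip]
  set S : ℝ := ∑ j, (∫ y, fderiv ℝ U y (esingle j) ∂ρ₀) * η j
  set A' := (∫ y, U (y - m') ∂ρ') - ∫ y, U (y - m) ∂ρ
  set L' := (∫ y, U y ∂ρ') - (∫ y, U y ∂ρ) - S
  have e1 : (∑ j, p j * m' j) + (∫ y, U (y - m') ∂ρ') - ((∑ j, p j * m j) + ∫ y, U (y - m) ∂ρ)
      = (∑ j, p j * (m' j - m j)) + A' := by
    simp only [mul_sub, Finset.sum_sub_distrib, A']
    ring
  have e2 : (∑ j, p j * ∫ y, Hfun χ q ρ₀ j y ∂ρ') + (∫ y, U y ∂ρ')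
      - ((∑ j, p j * ∫ y, Hfun χ q ρ₀ j y ∂ρ) + ∫ y, U y ∂ρ) - S = (∑ j, p j * η j) + L' := by
    simp only [hη, mul_sub, Finset.sum_sub_distrib, L']
    ring
  rw [e1, e2]
  refine abs_sq_sub_sq_le ?_ ?_ ?_
  · have e3 : (∑ j, p j * (m' j - m j)) + A' - ((∑ j, p j * η j) + L')
        = (∑ j, p j * (m' j - m j - η j)) + (A' - L') := by
      simp only [mul_sub, Finset.sum_sub_distrib]
      ring
    rw [e3]
    refine (abs_add_le _ _).trans ((add_le_add
      (abs_sum_three_mul_le hpj fun j => (hbounds j).2.2.2) hAL).trans ?_)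
    have : 0 ≤ ‖p‖ * (3 * C) * (τ * tvMol k ρ ρ₀) := by positivity
    simp only [K]
    linarith
  · refine (abs_add_le _ _).trans ((add_le_add
      (abs_sum_three_mul_le hpj fun j => (hbounds j).2.1) hA').trans (le_of_eq ?_))
    simp only [K]
    ring
  · refine (abs_add_le _ _).trans ((add_le_add
      (abs_sum_three_mul_le hpj fun j => (hbounds j).2.2.1) hL).trans (le_of_eq ?_))
    simp only [K]
    ring

end
end

section
/- Let v(y) := π^{−3/2}|y|^{−2} on ℝ³ and let g : ℝ³ → [0,∞) be measurable with g(y) ≤ A·e^{−γ|y|} for some constants A, γ > 0. Then there exists a constant C > 0 such that (g*v)(x) ≤ C·(1+|x|)^{−2} for all x ∈ ℝ³; moreover, the pointwise lower bound (g*v)(x) ≥ π^{−3/2}·(∫_{|y| ≤ 1} g(y)dy)·(1+|x|)^{−2} holds for all x ∈ ℝ³. -/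
open MeasureTheory Measure Set Metric Filter
open scoped ENNReal NNReal RealInnerProductSpace BigOperators FourierTransform

noncomputable section

/-- A negative sixth power of `1 + r` dominates a decaying exponential. -/
lemma exp_neg_mul_le_const_mul_inv_pow {γ : ℝ} (hγ : 0 < γ) {r : ℝ} (hr : 0 ≤ r) :
    Real.exp (-γ * r) ≤ 720 * Real.exp γ / γ ^ 6 * ((1 + r) ^ 6)⁻¹ := by
  have h := Real.pow_div_factorial_le_exp (x := γ * (1 + r)) (by positivity) 6
  have he : Real.exp (γ * (1 + r)) * Real.exp (-γ * r) = Real.exp γ := by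
    rw [← Real.exp_add]; congr 1; ring
  have h720 : ((Nat.factorial 6 : ℕ) : ℝ) = 720 := by norm_num [Nat.factorial]
  rw [h720] at h
  have h2 := mul_le_mul_of_nonneg_right h (Real.exp_pos (-γ * r)).le
  rw [he] at h2
  rw [← div_eq_mul_inv, div_div, le_div_iff₀ (by positivity)]
  rw [mul_pow] at h2
  linarith

lemma vPol_eq (y : E3) : vPol y = Real.pi ^ (-(3:ℝ)/2) * (‖y‖ ^ 2)⁻¹ := by
  rw [vPol, Real.rpow_neg (norm_nonneg y), Real.rpow_two]

lemma measurable_vPol : Measurable vPol := by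
  have : vPol = fun y => Real.pi ^ (-(3:ℝ)/2) * (‖y‖ ^ 2)⁻¹ := funext vPol_eq
  rw [this]
  fun_prop

/-- The inverse-square singularity, cut off to the unit ball. -/
def localInvSq : E3 → ℝ := (ball (0 : E3) 1).indicator fun z => (‖z‖ ^ 2)⁻¹

lemma localInvSq_nonneg (z : E3) : 0 ≤ localInvSq z :=
  indicator_nonneg (fun _ _ => by positivity) z

lemma integrable_localInvSq : Integrable localInvSq := by
  rw [localInvSq, integrable_indicator_iff measurableSet_ball]
  refine integrableOn_ball_of_norm_le_rpow (C := 1) (α := 2) (by simp) (by norm_num) ?_ ?_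
  · refine Eventually.of_forall fun z => ?_
    rw [Real.rpow_neg (norm_nonneg z), Real.rpow_two, one_mul,
      Real.norm_of_nonneg (by positivity)]
  · exact Measurable.aestronglyMeasurable (by fun_prop)

lemma integrable_inv_one_add_norm_pow_four : Integrable fun y : E3 => ((1 + ‖y‖) ^ 4)⁻¹ := by
  have h : Integrable fun y : E3 => (1 + ‖y‖) ^ (-(4:ℝ)) :=
    integrable_one_add_norm (by norm_num)
  refine h.congr (Eventually.of_forall fun y => ?_)
  have h4 : (4:ℝ) = ((4:ℕ):ℝ) := by norm_num
  simp only
  rw [Real.rpow_neg (by positivity), h4, Real.rpow_natCast]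

/-- Pointwise splitting of the convolution integrand into an integrable tail and an integrable
local singularity. -/
lemma inv_pow_six_mul_inv_sq_le (x y : E3) :
    ((1 + ‖y‖) ^ 6)⁻¹ * (‖x - y‖ ^ 2)⁻¹
      ≤ 4 * (((1 + ‖y‖) ^ 4)⁻¹ + localInvSq (x - y)) * ((1 + ‖x‖) ^ 2)⁻¹ := by
  have hk := localInvSq_nonneg (x - y)
  have hx : 1 + ‖x‖ ≤ (1 + ‖y‖) * (1 + ‖x - y‖) := by
    have h1 : ‖x‖ ≤ ‖x - y‖ + ‖y‖ := by simpa using norm_add_le (x - y) y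
    nlinarith [mul_nonneg (norm_nonneg y) (norm_nonneg (x - y))]
  rw [← div_eq_mul_inv _ ((1 + ‖x‖) ^ 2), le_div_iff₀ (by positivity)]
  have hsq : (1 + ‖x‖) ^ 2 ≤ (1 + ‖y‖) ^ 2 * (1 + ‖x - y‖) ^ 2 := by
    rw [← mul_pow]; gcongr
  have hstep : ((1 + ‖y‖) ^ 6)⁻¹ * (‖x - y‖ ^ 2)⁻¹ * (1 + ‖x‖) ^ 2
      ≤ ((1 + ‖y‖) ^ 4)⁻¹ * ((1 + ‖x - y‖) ^ 2 * (‖x - y‖ ^ 2)⁻¹) := by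
    calc _ ≤ ((1 + ‖y‖) ^ 6)⁻¹ * (‖x - y‖ ^ 2)⁻¹ * ((1 + ‖y‖) ^ 2 * (1 + ‖x - y‖) ^ 2) := by
          gcongr
      _ = _ := by
          have : (1 + ‖y‖) ≠ 0 := by positivity
          have h6 : ((1 + ‖y‖) ^ 6)⁻¹ * (1 + ‖y‖) ^ 2 = ((1 + ‖y‖) ^ 4)⁻¹ := by field_simp
          rw [← h6]; ring
  refine hstep.trans ?_
  have hp : 0 ≤ ((1 + ‖y‖) ^ 4)⁻¹ := by positivity
  have hu := norm_nonneg (x - y)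
  rcases lt_or_ge ‖x - y‖ 1 with h | h
  · have hmem : x - y ∈ ball (0 : E3) 1 := by simpa using h
    have hkeq : localInvSq (x - y) = (‖x - y‖ ^ 2)⁻¹ := indicator_of_mem hmem _
    have hp1 : ((1 + ‖y‖) ^ 4)⁻¹ ≤ 1 :=
      inv_le_one_of_one_le₀ (one_le_pow₀ (by linarith [norm_nonneg y]))
    have h4 : (1 + ‖x - y‖) ^ 2 ≤ 4 := by nlinarith
    rw [hkeq]
    calc _ ≤ 1 * (4 * (‖x - y‖ ^ 2)⁻¹) := by gcongr
      _ ≤ _ := by linarith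
  · have h4 : (1 + ‖x - y‖) ^ 2 * (‖x - y‖ ^ 2)⁻¹ ≤ 4 := by
      rw [← div_eq_mul_inv, div_le_iff₀ (by positivity)]; nlinarith
    nlinarith [mul_le_mul_of_nonneg_left h4 hp]

/-- two-sided decay of the convolution of an exponentially decaying
function with the polaron interaction `v(y) = π^{-3/2}|y|^{-2}`. -/
theorem stmt14 (g : E3 → ℝ) (hmeas : Measurable g) (hg0 : ∀ y, 0 ≤ g y)
    (A γ : ℝ) (hA : 0 < A) (hγ : 0 < γ)
    (hbound : ∀ y, g y ≤ A * Real.exp (-γ * ‖y‖)) :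
    (∃ C > (0:ℝ), ∀ x : E3, (∫ y, g y * vPol (x - y)) ≤ C * ((1 + ‖x‖)^2)⁻¹) ∧
    (∀ x : E3, Real.pi ^ (-(3:ℝ)/2) * (∫ y in Metric.closedBall (0:E3) 1, g y)
        * ((1 + ‖x‖)^2)⁻¹ ≤ ∫ y, g y * vPol (x - y)) := by
  have hc : 0 < Real.pi ^ (-(3:ℝ)/2) := Real.rpow_pos_of_pos Real.pi_pos _
  set c := Real.pi ^ (-(3:ℝ)/2)
  obtain ⟨M, hM, hgM⟩ : ∃ M > 0, ∀ y, g y ≤ M * ((1 + ‖y‖) ^ 6)⁻¹ := by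
    refine ⟨A * (720 * Real.exp γ / γ ^ 6), by positivity, fun y => (hbound y).trans ?_⟩
    rw [mul_assoc]
    exact mul_le_mul_of_nonneg_left
      (exp_neg_mul_le_const_mul_inv_pow hγ (norm_nonneg y)) hA.le
  have hpt : ∀ x y, g y * vPol (x - y) ≤
      4 * c * M * ((1 + ‖x‖) ^ 2)⁻¹ * (((1 + ‖y‖) ^ 4)⁻¹ + localInvSq (x - y)) := by
    intro x y
    rw [vPol_eq]
    calc g y * (c * (‖x - y‖ ^ 2)⁻¹)
        ≤ M * ((1 + ‖y‖) ^ 6)⁻¹ * (c * (‖x - y‖ ^ 2)⁻¹) := by gcongr; exact hgM y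
      _ = c * M * (((1 + ‖y‖) ^ 6)⁻¹ * (‖x - y‖ ^ 2)⁻¹) := by ring
      _ ≤ c * M * (4 * (((1 + ‖y‖) ^ 4)⁻¹ + localInvSq (x - y)) * ((1 + ‖x‖) ^ 2)⁻¹) := by
        gcongr ?_ * ?_
        exact inv_pow_six_mul_inv_sq_le x y
      _ = _ := by ring
  have hv0 : ∀ z, 0 ≤ vPol z := fun z => by rw [vPol_eq]; positivity
  have hdom : ∀ x : E3,
      Integrable fun y => ((1 + ‖y‖) ^ 4)⁻¹ + localInvSq (x - y) := fun x =>
    integrable_inv_one_add_norm_pow_four.add (integrable_localInvSq.comp_sub_left x)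
  have hint : ∀ x : E3, Integrable fun y => g y * vPol (x - y) := by
    intro x
    refine ((hdom x).const_mul (4 * c * M * ((1 + ‖x‖) ^ 2)⁻¹)).mono'
      (hmeas.mul (measurable_vPol.comp (measurable_const.sub measurable_id))).aestronglyMeasurable
      (Eventually.of_forall fun y => ?_)
    rw [Real.norm_of_nonneg (mul_nonneg (hg0 y) (hv0 _))]
    exact hpt x y
  have hgint : Integrable g := by
    refine (integrable_inv_one_add_norm_pow_four.const_mul M).mono' hmeas.aestronglyMeasurable
      (Eventually.of_forall fun y => ?_)
    rw [Real.norm_of_nonneg (hg0 y)]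
    refine (hgM y).trans ?_
    gcongr
    · linarith [norm_nonneg y]
    · norm_num
  refine ⟨⟨4 * c * M * ((∫ y : E3, ((1 + ‖y‖) ^ 4)⁻¹) + ∫ z, localInvSq z) + 1, ?_, ?_⟩, ?_⟩
  · have h1 : 0 ≤ ∫ y : E3, ((1 + ‖y‖) ^ 4)⁻¹ := integral_nonneg fun y => by positivity
    have h2 : 0 ≤ ∫ z, localInvSq z := integral_nonneg localInvSq_nonneg
    positivity
  · intro x
    calc ∫ y, g y * vPol (x - y)
        ≤ ∫ y, 4 * c * M * ((1 + ‖x‖) ^ 2)⁻¹ * (((1 + ‖y‖) ^ 4)⁻¹ + localInvSq (x - y)) :=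
          integral_mono (hint x) ((hdom x).const_mul _) (hpt x)
      _ = 4 * c * M * ((∫ y : E3, ((1 + ‖y‖) ^ 4)⁻¹) + ∫ z, localInvSq z)
            * ((1 + ‖x‖) ^ 2)⁻¹ := by
          rw [integral_const_mul, integral_add integrable_inv_one_add_norm_pow_four
            (integrable_localInvSq.comp_sub_left x), integral_sub_left_eq_self localInvSq]
          ring
      _ ≤ _ := by gcongr; linarith
  · intro x
    calc c * (∫ y in closedBall (0:E3) 1, g y) * ((1 + ‖x‖) ^ 2)⁻¹
        = ∫ y in closedBall (0:E3) 1, g y * (c * ((1 + ‖x‖) ^ 2)⁻¹) := by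
          rw [integral_mul_const]; ring
      _ ≤ ∫ y in closedBall (0:E3) 1, g y * vPol (x - y) := by
          refine integral_mono_ae (hgint.integrableOn.mul_const _) (hint x).integrableOn ?_
          filter_upwards [ae_restrict_mem measurableSet_closedBall,
            ae_restrict_of_ae (Measure.ae_ne volume x)] with y hy hne
          have hy1 : ‖y‖ ≤ 1 := by simpa using hy
          have hpos : 0 < ‖x - y‖ := norm_pos_iff.2 (sub_ne_zero.2 hne.symm)
          have hle : ‖x - y‖ ≤ 1 + ‖x‖ := by linarith [norm_sub_le x y]
          rw [vPol_eq]
          have := hg0 y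
          gcongr
      _ ≤ ∫ y, g y * vPol (x - y) :=
          setIntegral_le_integral (hint x)
            (Eventually.of_forall fun y => mul_nonneg (hg0 y) (hv0 _))

end
end

section
/- Fix constants a > 0, R* > 0, δ* > 0 and 0 < κ < σ with σ + κ < a, and let β₁, β₂ : ℝ → [0,1] be smooth with β₁² + β₂² = 1, β₁(t) = 1 for t ≤ −1 and β₁(t) = 0 for t ≥ 1. Define for a finite Borel measure ρ on ℝ³: F(ρ) := β₁( ((ρ(ℝ³) − a)² + (∬_{|x−y| > R*} dρ(x)dρ(y) − δ*)² − σ²)/κ² ). Then there exist constants C > 0 and ε₀ > 0 such that for every finite Borel measure ρ on ℝ³, every y ∈ ℝ³ and every 0 < ε ≤ ε₀: |F(ρ + ε·δ_y) − F(ρ)| ≤ C·ε and |√(1 − F(ρ + ε·δ_y)²) − √(1 − F(ρ)²)| ≤ C·ε, where δ_y denotes the Dirac measure at y. -/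
open MeasureTheory Measure Set Metric Filter
open scoped ENNReal NNReal RealInnerProductSpace BigOperators FourierTransform

noncomputable section

/-- A `C¹` function on `ℝ` is Lipschitz on compact intervals. -/
theorem exists_lipschitz_on_Icc {g : ℝ → ℝ} (hg : ContDiff ℝ 1 g) (A B : ℝ) :
    ∃ K : ℝ, 0 ≤ K ∧ ∀ s ∈ Set.Icc A B, ∀ t ∈ Set.Icc A B, |g s - g t| ≤ K * |s - t| := by
  obtain ⟨K, hK⟩ := (isCompact_Icc (a := A) (b := B)).exists_bound_of_continuousOn
    (hg.continuous_deriv le_rfl).continuousOn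
  refine ⟨max K 0, le_max_right _ _, fun s hs t ht => ?_⟩
  exact (convex_Icc A B).norm_image_sub_le_of_norm_deriv_le
    (fun x _ => (hg.differentiable one_ne_zero).differentiableAt)
    (fun x hx => (hK x hx).trans (le_max_left _ _)) ht hs

/-- A `C¹` function that is constant on `[τ, ∞)`, evaluated at `(m - a)² + (p - δ)² - s`, changes
by `O(ε)` when `m` grows by `ε` and `p` grows by at most `ε (2 m + ε)`. -/
theorem exists_increment_bound {g : ℝ → ℝ} (hg : ContDiff ℝ 1 g) {a δ s τ c : ℝ}
    (ha : 0 < a) (hδ : 0 < δ) (hs : 0 ≤ s) (hsτ : τ + s ≤ a ^ 2) (hc : ∀ t, τ ≤ t → g t = c) :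
    ∃ C > (0 : ℝ), ∀ m p p' ε : ℝ, 0 ≤ m → 0 ≤ p → p ≤ p' → p' ≤ p + ε * (2 * m + ε) →
      0 < ε → ε ≤ 1 →
      |g ((m + ε - a) ^ 2 + (p' - δ) ^ 2 - s) - g ((m - a) ^ 2 + (p - δ) ^ 2 - s)| ≤ C * ε := by
  obtain ⟨K, hK0, hK⟩ := exists_lipschitz_on_Icc hg (-s)
    ((3 * a + 1) ^ 2 + (5 * a + 1 + 2 * δ) ^ 2)
  set L : ℝ := (6 * a + 1) + (4 * a + 1) * (10 * a + 2 + 4 * δ) with hL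
  have hL0 : 0 < L := by positivity
  refine ⟨K * L + 1, by positivity, fun m p p' ε hm hp hpp' hp' hε hε1 => ?_⟩
  by_cases hfar : τ ≤ (m + ε - a) ^ 2 + (p' - δ) ^ 2 - s ∧ τ ≤ (m - a) ^ 2 + (p - δ) ^ 2 - s
  · rw [hc _ hfar.1, hc _ hfar.2, sub_self, abs_zero]
    positivity
  have hnear : m ≤ 2 * a ∧ p ≤ δ + a := by
    rw [not_and_or, not_le, not_le] at hfar
    rcases hfar with h | h
    · have h1 : |m + ε - a| ≤ a := abs_le_of_sq_le_sq (by nlinarith [sq_nonneg (p' - δ)]) ha.le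
      have h2 : |p' - δ| ≤ a := abs_le_of_sq_le_sq (by nlinarith [sq_nonneg (m + ε - a)]) ha.le
      rw [abs_le] at h1 h2
      constructor <;> linarith
    · have h1 : |m - a| ≤ a := abs_le_of_sq_le_sq (by nlinarith [sq_nonneg (p - δ)]) ha.le
      have h2 : |p - δ| ≤ a := abs_le_of_sq_le_sq (by nlinarith [sq_nonneg (m - a)]) ha.le
      rw [abs_le] at h1 h2
      constructor <;> linarith
  obtain ⟨hm2, hp2⟩ := hnear
  have hdp : p' - p ≤ (4 * a + 1) * ε := by nlinarith
  have hp'2 : p' ≤ δ + 5 * a + 1 := by nlinarith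
  have hsq : ∀ x b : ℝ, -b ≤ x → x ≤ b → x ^ 2 ≤ b ^ 2 := fun x b h1 h2 => sq_le_sq' h1 h2
  have hmem : ∀ x q : ℝ, 0 ≤ x → x ≤ 2 * a + 1 → 0 ≤ q → q ≤ δ + 5 * a + 1 →
      (x - a) ^ 2 + (q - δ) ^ 2 - s ∈
        Set.Icc (-s) ((3 * a + 1) ^ 2 + (5 * a + 1 + 2 * δ) ^ 2) := by
    intro x q hx hx' hq hq'
    have h1 := hsq (x - a) (3 * a + 1) (by linarith) (by linarith)
    have h2 := hsq (q - δ) (5 * a + 1 + 2 * δ) (by linarith) (by linarith)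
    constructor
    · nlinarith [sq_nonneg (x - a), sq_nonneg (q - δ)]
    · linarith
  have hdiff : |((m + ε - a) ^ 2 + (p' - δ) ^ 2 - s) - ((m - a) ^ 2 + (p - δ) ^ 2 - s)|
      ≤ L * ε := by
    have heq : ((m + ε - a) ^ 2 + (p' - δ) ^ 2 - s) - ((m - a) ^ 2 + (p - δ) ^ 2 - s)
        = ε * (2 * m + ε - 2 * a) + (p' - p) * (p' + p - 2 * δ) := by ring
    have h1 : |ε * (2 * m + ε - 2 * a)| ≤ ε * (6 * a + 1) := by
      rw [abs_mul, abs_of_pos hε]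
      gcongr
      rw [abs_le]
      constructor <;> linarith
    have h2 : |(p' - p) * (p' + p - 2 * δ)| ≤ ((4 * a + 1) * ε) * (10 * a + 2 + 4 * δ) := by
      rw [abs_mul, abs_of_nonneg (sub_nonneg.2 hpp')]
      gcongr
      rw [abs_le]
      constructor <;> linarith
    rw [heq]
    refine (abs_add_le _ _).trans ((add_le_add h1 h2).trans_eq ?_)
    rw [hL]
    ring
  calc |g ((m + ε - a) ^ 2 + (p' - δ) ^ 2 - s) - g ((m - a) ^ 2 + (p - δ) ^ 2 - s)|
      ≤ K * |((m + ε - a) ^ 2 + (p' - δ) ^ 2 - s) - ((m - a) ^ 2 + (p - δ) ^ 2 - s)| :=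
        hK _ (hmem _ _ (by linarith) (by linarith) (by linarith) hp'2)
          _ (hmem _ _ hm (by linarith) hp (by linarith))
    _ ≤ K * (L * ε) := by gcongr
    _ ≤ (K * L + 1) * ε := by linarith

/-- Adding an atom of mass `ε` increases the total mass by `ε`. -/
theorem toReal_add_dirac_univ (ρ : Measure E3) [IsFiniteMeasure ρ] (y : E3) {ε : ℝ}
    (hε : 0 ≤ ε) :
    ((ρ + ENNReal.ofReal ε • Measure.dirac y) Set.univ).toReal
      = (ρ Set.univ).toReal + ε := by
  simp [ENNReal.toReal_add, hε]

/-- The pair correlation is monotone in the measure. -/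
theorem pairF_mono (R : ℝ) {μ ν : Measure E3} [IsFiniteMeasure μ] [IsFiniteMeasure ν]
    (h : μ ≤ ν) : pairF R μ ≤ pairF R ν :=
  ENNReal.toReal_mono (measure_ne_top _ _) (Measure.prod_mono h h _)

/-- Adding a measure `ν` to `μ` increases the pair correlation by at most
`2 μ(ℝ³) ν(ℝ³) + ν(ℝ³)²`. -/
theorem pairF_add_le (R : ℝ) (μ ν : Measure E3) [IsFiniteMeasure μ] [IsFiniteMeasure ν] :
    pairF R (μ + ν) ≤ pairF R μ
      + (ν Set.univ).toReal * (2 * (μ Set.univ).toReal + (ν Set.univ).toReal) := by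
  have hle : ∀ α β : Measure E3, IsFiniteMeasure α → IsFiniteMeasure β →
      ((α.prod β) {q : E3 × E3 | R < dist q.1 q.2}).toReal
        ≤ (α Set.univ).toReal * (β Set.univ).toReal := by
    intro α β _ _
    rw [← ENNReal.toReal_mul, ← Measure.prod_prod, Set.univ_prod_univ]
    exact ENNReal.toReal_mono (measure_ne_top _ _) (measure_mono (Set.subset_univ _))
  have h1 := hle μ ν inferInstance inferInstance
  have h2 := hle ν μ inferInstance inferInstance
  have h3 := hle ν ν inferInstance inferInstance
  unfold pairF
  rw [Measure.prod_add, Measure.add_prod, Measure.add_prod]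
  simp only [Measure.add_apply]
  rw [ENNReal.toReal_add (by finiteness) (by finiteness),
    ENNReal.toReal_add (by finiteness) (by finiteness),
    ENNReal.toReal_add (by finiteness) (by finiteness)]
  linarith

/-- Lipschitz estimate for `F` and `√(1-F²)` under adding a small atom. -/
theorem stmt16 (a Rstar δstar κ σ : ℝ)
    (ha : 0 < a) (hR : 0 < Rstar) (hδstar : 0 < δstar) (hκ : 0 < κ) (hκσ : κ < σ)
    (hσκ : σ + κ < a)
    (β₁ β₂ : ℝ → ℝ) (hβ₁smooth : ContDiff ℝ (⊤ : ℕ∞) β₁) (hβ₂smooth : ContDiff ℝ (⊤ : ℕ∞) β₂)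
    (hβ₁range : ∀ t, β₁ t ∈ Set.Icc (0:ℝ) 1) (hβ₂range : ∀ t, β₂ t ∈ Set.Icc (0:ℝ) 1)
    (hsq : ∀ t, (β₁ t)^2 + (β₂ t)^2 = 1)
    (hβone : ∀ t : ℝ, t ≤ -1 → β₁ t = 1) (hβzero : ∀ t : ℝ, 1 ≤ t → β₁ t = 0) :
    ∃ C > (0:ℝ), ∃ ε₀ > (0:ℝ),
      ∀ (ρ : Measure E3) [IsFiniteMeasure ρ], ∀ (y : E3) (ε : ℝ), 0 < ε → ε ≤ ε₀ →
        |Fcut a Rstar δstar κ σ β₁ (ρ + (ENNReal.ofReal ε) • Measure.dirac y)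
            - Fcut a Rstar δstar κ σ β₁ ρ| ≤ C * ε ∧
        |Real.sqrt (1 - (Fcut a Rstar δstar κ σ β₁
              (ρ + (ENNReal.ofReal ε) • Measure.dirac y))^2)
            - Real.sqrt (1 - (Fcut a Rstar δstar κ σ β₁ ρ)^2)| ≤ C * ε := by
  have hκ2 : κ ^ 2 ≠ 0 := by positivity
  have hbound : κ ^ 2 + σ ^ 2 ≤ a ^ 2 := by nlinarith
  have hsmooth : ∀ β : ℝ → ℝ, ContDiff ℝ (⊤ : ℕ∞) β → ContDiff ℝ 1 fun t => β (t / κ ^ 2) :=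
    fun β hβ => (hβ.of_le (by exact_mod_cast le_top)).comp (contDiff_id.div_const _)
  have hone : ∀ t, κ ^ 2 ≤ t → 1 ≤ t / κ ^ 2 := fun t ht => by
    rwa [le_div_iff₀ (by positivity), one_mul]
  have hβ₂one : ∀ t : ℝ, 1 ≤ t → β₂ t = 1 := fun t ht => by
    have h := hsq t
    rw [hβzero t ht] at h
    nlinarith [(hβ₂range t).1]
  have hsqrt : ∀ t, Real.sqrt (1 - (β₁ t) ^ 2) = β₂ t := fun t => by
    rw [← hsq t, add_sub_cancel_left, Real.sqrt_sq (hβ₂range t).1]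
  obtain ⟨C₁, hC₁, h₁⟩ := exists_increment_bound (hsmooth β₁ hβ₁smooth) ha hδstar (sq_nonneg σ)
    hbound fun t ht => hβzero _ (hone t ht)
  obtain ⟨C₂, hC₂, h₂⟩ := exists_increment_bound (hsmooth β₂ hβ₂smooth) ha hδstar (sq_nonneg σ)
    hbound fun t ht => hβ₂one _ (hone t ht)
  refine ⟨max C₁ C₂, lt_max_of_lt_left hC₁, 1, one_pos, fun ρ _ y ε hε hε1 => ?_⟩
  have : IsFiniteMeasure (ENNReal.ofReal ε • Measure.dirac y) :=
    Measure.smul_finite _ ENNReal.ofReal_ne_top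
  have hlow : pairF Rstar ρ ≤ pairF Rstar (ρ + ENNReal.ofReal ε • Measure.dirac y) :=
    pairF_mono Rstar (Measure.le_add_right le_rfl)
  have hup := pairF_add_le Rstar ρ (ENNReal.ofReal ε • Measure.dirac y)
  have hmass : ((ENNReal.ofReal ε • Measure.dirac y : Measure E3) Set.univ).toReal = ε := by
    simp [hε.le]
  rw [hmass] at hup
  unfold Fcut
  rw [hsqrt, hsqrt, toReal_add_dirac_univ ρ y hε.le]
  constructor
  · exact (h₁ _ _ _ ε ENNReal.toReal_nonneg ENNReal.toReal_nonneg hlow hup hε hε1).trans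
      (by gcongr; exact le_max_left _ _)
  · exact (h₂ _ _ _ ε ENNReal.toReal_nonneg ENNReal.toReal_nonneg hlow hup hε hε1).trans
      (by gcongr; exact le_max_right _ _)

end
end
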